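/- arXiv:1803.05943 — 11 statements merged into one kernel-verified Lean document; each statement's English description precedes it below -/
import Mathlib

section
/- Let A be an Appell sequence with Σ_{n≥0} |A_n(0)| r^n/n! < ∞ for some r > 0, and let u = (u_n)_{n≥0} be a real sequence with u_0 ≠ 0 and Σ_{n≥0} |u_n| s^n/n! < ∞ for some s > 0. Let t > 0 be the unique positive solution of t·e^t = s and set ρ = min(r, t). Then for every real x and every complex z with |z| ≤ ρ, the series Σ_{n≥0} (L_u A)_n(x) z^n/n!, Σ_{n≥0} A_n(0) z^n/n!, and Σ_{k≥0} u_k (e^z − 1)^k/k! converge absolutely, and Σ_{n≥0} (L_u A)_n(x) z^n/n! = (Σ_{n≥0} A_n(0) z^n/n!) · (Σ_{k≥0} u_k (e^z − 1)^k/k!) · e^{xz}. -/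
open Finset MeasureTheory

/-- The `k`-th forward difference of `f : ℝ → ℝ`:
`Δ^k f(x) = ∑_{j=0}^k C(k,j) (-1)^(k-j) f(x+j)`. -/
noncomputable def fdiff (k : ℕ) (f : ℝ → ℝ) (x : ℝ) : ℝ :=
  ∑ j ∈ Finset.range (k + 1), (k.choose j : ℝ) * (-1 : ℝ) ^ (k - j) * f (x + j)

/-- The `k`-th forward difference of a real polynomial, as a polynomial;
its evaluation at `x` is `∑_{j=0}^k C(k,j) (-1)^(k-j) p(x+j)`. -/
noncomputable def fdiffP (k : ℕ) (p : Polynomial ℝ) : Polynomial ℝ :=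
  ∑ j ∈ Finset.range (k + 1),
    ((k.choose j : ℝ) * (-1 : ℝ) ^ (k - j)) • p.comp (Polynomial.X + Polynomial.C (j : ℝ))

/-- An Appell sequence of real polynomials: `A 0` is a nonzero constant and
`A n' = n • A (n-1)` for `n ≥ 1`. -/
def IsAppell (A : ℕ → Polynomial ℝ) : Prop :=
  (A 0).eval 0 ≠ 0 ∧ (∃ c : ℝ, A 0 = Polynomial.C c) ∧
    ∀ n : ℕ, (A (n + 1)).derivative = ((n : ℝ) + 1) • A n

/-- The forward difference transformation `L_u A`, with
`(L_u A)_n(x) = ∑_{k=0}^n (u_k/k!) Δ^k A_n(x)`. -/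
noncomputable def LP (u : ℕ → ℝ) (A : ℕ → Polynomial ℝ) (n : ℕ) : Polynomial ℝ :=
  ∑ k ∈ Finset.range (n + 1), (u k / (k.factorial : ℝ)) • fdiffP k (A n)

/-- Binomial convolution of real sequences. -/
noncomputable def bconv (u v : ℕ → ℝ) (n : ℕ) : ℝ :=
  ∑ k ∈ Finset.range (n + 1), (n.choose k : ℝ) * u k * v (n - k)

/-- Binomial convolution of Appell sequences:
`(A×C)_n(x) = ∑_{k=0}^n C(n,k) A_k(0) C_{n-k}(x)`. -/
noncomputable def aconv (A C : ℕ → Polynomial ℝ) (n : ℕ) : Polynomial ℝ :=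
  ∑ k ∈ Finset.range (n + 1), ((n.choose k : ℝ) * (A k).eval 0) • C (n - k)

/-- Stirling numbers of the second kind (real-valued):
`S(n,k) = (1/k!) ∑_{j=0}^k (-1)^(k-j) C(k,j) j^n`. -/
noncomputable def stirling2 (n k : ℕ) : ℝ :=
  (1 / (k.factorial : ℝ)) *
    ∑ j ∈ Finset.range (k + 1), (-1 : ℝ) ^ (k - j) * (k.choose j : ℝ) * (j : ℝ) ^ n

/-- Signed Stirling numbers of the first kind: the coefficient of `x^k` in
`x(x-1)⋯(x-n+1)`. -/
noncomputable def stirling1 (n k : ℕ) : ℝ :=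
  (∏ i ∈ Finset.range n, (Polynomial.X - Polynomial.C (i : ℝ))).coeff k

/-- Generalized binomial coefficient `C(y,k) = y(y-1)⋯(y-k+1)/k!`. -/
noncomputable def rchoose (y : ℝ) (k : ℕ) : ℝ :=
  (∏ i ∈ Finset.range k, (y - i)) / (k.factorial : ℝ)

/-- Apostol-Euler polynomials `E_n(β;x) = ∑_{k=0}^n (-β)^k Δ^k I_n(x)`. -/
noncomputable def apostolEuler (β : ℝ) (n : ℕ) (x : ℝ) : ℝ :=
  ∑ k ∈ Finset.range (n + 1), (-β) ^ k * fdiff k (fun y => y ^ n) x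

/-- Harmonic numbers `H_j = ∑_{i=1}^j 1/i`. -/
noncomputable def harm (j : ℕ) : ℝ := ∑ i ∈ Finset.range j, (1 : ℝ) / (i + 1)

open PowerSeries in
/-- The coefficients of `(e^X - 1)^k`, as forward differences of powers at `0`. -/
theorem coeff_exp_sub_one_pow (k m : ℕ) :
    coeff m ((exp ℝ - 1) ^ k) = ∑ j ∈ range (k + 1),
      (k.choose j : ℝ) * (-1 : ℝ) ^ (k - j) * ((j : ℝ) ^ m / (m.factorial : ℝ)) := by
  rw [sub_eq_add_neg, add_pow, map_sum]
  refine sum_congr rfl fun j _ => ?_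
  have h : exp ℝ ^ j * (-1) ^ (k - j) * (k.choose j : ℝ⟦X⟧)
      = C ((k.choose j : ℝ) * (-1 : ℝ) ^ (k - j)) * exp ℝ ^ j := by
    simp only [map_mul, map_pow, map_neg, map_one, map_natCast]
    ring
  rw [h, coeff_C_mul, exp_pow_eq_rescale_exp, coeff_rescale, coeff_exp]
  simp [div_eq_mul_inv]

open PowerSeries in
theorem coeff_exp_sub_one_pow_nonneg (k m : ℕ) : 0 ≤ coeff m ((exp ℝ - 1) ^ k) := by
  have h₁ (m : ℕ) : 0 ≤ coeff m (exp ℝ - 1) := by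
    rcases m with _ | m
    · simp
    · simp only [map_sub, coeff_exp, coeff_one, Nat.add_eq_zero_iff, one_ne_zero, and_false,
        if_false, sub_zero, map_div₀, map_one, map_natCast]
      positivity
  induction k generalizing m with
  | zero => rw [pow_zero, coeff_one]; split_ifs <;> norm_num
  | succ k ih =>
    rw [pow_succ, coeff_mul]
    exact sum_nonneg fun p _ => mul_nonneg (ih _) (h₁ _)

open PowerSeries in
theorem coeff_exp_sub_one_pow_of_lt {k m : ℕ} (h : m < k) :
    coeff m ((exp ℝ - 1) ^ k) = 0 :=
  X_pow_dvd_iff.1 (pow_dvd_pow_of_dvd (X_dvd_iff.2 (by simp)) k) m h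

theorem Complex.hasSum_pow_div_factorial (w : ℂ) :
    HasSum (fun n : ℕ => w ^ n / (n.factorial : ℂ)) (Complex.exp w) := by
  rw [Complex.exp_eq_exp_ℂ]
  exact NormedSpace.expSeries_div_hasSum_exp w

open PowerSeries in
theorem hasSum_exp_sub_one_pow (k : ℕ) (w : ℂ) :
    HasSum (fun m => ((coeff m ((exp ℝ - 1) ^ k) : ℝ) : ℂ) * w ^ m)
      ((Complex.exp w - 1) ^ k) := by
  have h : HasSum (fun m : ℕ => ∑ j ∈ range (k + 1), (k.choose j : ℂ) * (-1 : ℂ) ^ (k - j) *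
        (((j : ℂ) * w) ^ m / (m.factorial : ℂ)))
      (∑ j ∈ range (k + 1), (k.choose j : ℂ) * (-1 : ℂ) ^ (k - j) * Complex.exp (j * w)) :=
    hasSum_sum fun j _ => (Complex.hasSum_pow_div_factorial _).mul_left _
  convert h using 1
  · funext m
    rw [coeff_exp_sub_one_pow]
    push_cast
    rw [sum_mul]
    refine sum_congr rfl fun j _ => ?_
    ring
  · rw [sub_eq_add_neg, add_pow]
    refine sum_congr rfl fun j _ => ?_
    rw [Complex.exp_nat_mul]
    ring

open PowerSeries in
theorem hasSum_exp_sub_one_pow_real (k : ℕ) (w : ℝ) :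
    HasSum (fun m => coeff m ((exp ℝ - 1) ^ k) * w ^ m) ((Real.exp w - 1) ^ k) := by
  have h := hasSum_exp_sub_one_pow k (w : ℂ)
  rw [← Complex.hasSum_ofReal]
  convert h using 1 <;> push_cast <;> rfl

theorem norm_exp_sub_one_pow_le (k : ℕ) (z : ℂ) :
    ‖(Complex.exp z - 1) ^ k‖ ≤ (Real.exp ‖z‖ - 1) ^ k := by
  rw [← (hasSum_exp_sub_one_pow k z).tsum_eq]
  refine tsum_of_norm_bounded (hasSum_exp_sub_one_pow_real k ‖z‖) fun m => ?_
  simp [abs_of_nonneg (coeff_exp_sub_one_pow_nonneg k m)]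

theorem IsAppell.natDegree_le {A : ℕ → Polynomial ℝ} (hA : IsAppell A) (n : ℕ) :
    (A n).natDegree ≤ n := by
  induction n with
  | zero =>
    obtain ⟨c, hc⟩ := hA.2.1
    simp [hc]
  | succ n ih =>
    have h := Polynomial.natDegree_derivative (A (n + 1))
    rw [hA.2.2 n] at h
    have := (Polynomial.natDegree_smul_le ((n : ℝ) + 1) (A n)).trans ih
    omega

theorem IsAppell.iterate_derivative {A : ℕ → Polynomial ℝ} (hA : IsAppell A) (i m : ℕ) :
    (i.factorial : ℝ) • Polynomial.derivative^[m] (A (i + m))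
      = ((i + m).factorial : ℝ) • A i := by
  induction m with
  | zero => simp
  | succ m ih =>
    rw [Function.iterate_succ_apply, ← add_assoc, hA.2.2, Polynomial.iterate_derivative_smul,
      smul_comm, ih, smul_smul, Nat.factorial_succ (i + m)]
    push_cast
    rfl

/-- The Appell addition formula. -/
theorem IsAppell.eval_add {A : ℕ → Polynomial ℝ} (hA : IsAppell A) (n : ℕ) (x y : ℝ) :
    (A n).eval (x + y) / (n.factorial : ℝ) = ∑ p ∈ antidiagonal n,
      (A p.1).eval x / (p.1.factorial : ℝ) * (y ^ p.2 / (p.2.factorial : ℝ)) := by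
  have hdeg : (Polynomial.taylor x (A n)).natDegree < n + 1 := by
    rw [Polynomial.natDegree_taylor]
    exact Nat.lt_succ_of_le (hA.natDegree_le n)
  rw [add_comm x y, ← Polynomial.taylor_eval, Polynomial.eval_eq_sum_range' hdeg,
    ← Nat.sum_antidiagonal_eq_sum_range_succ_mk
      (fun p => (Polynomial.taylor x (A n)).coeff p.1 * y ^ p.1), ← Nat.sum_antidiagonal_swap,
    sum_div]
  refine sum_congr rfl fun ⟨i, m⟩ hp => ?_
  obtain rfl : i + m = n := by simpa using hp
  have h := congrArg (Polynomial.eval x) (hA.iterate_derivative i m)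
  rw [← Polynomial.factorial_smul_hasseDeriv, LinearMap.smul_apply] at h
  simp only [Polynomial.eval_smul, smul_eq_mul, nsmul_eq_mul, Polynomial.eval_mul,
    Polynomial.eval_natCast] at h
  simp only [Prod.fst_swap, Polynomial.taylor_coeff]
  have hi : (i.factorial : ℝ) ≠ 0 := by positivity
  have hm : (m.factorial : ℝ) ≠ 0 := by positivity
  have him : ((i + m).factorial : ℝ) ≠ 0 := by positivity
  field_simp
  linear_combination y ^ m * h

open PowerSeries in
theorem IsAppell.eval_fdiffP {A : ℕ → Polynomial ℝ} (hA : IsAppell A) (k n : ℕ) (x : ℝ) :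
    (fdiffP k (A n)).eval x / (n.factorial : ℝ) = ∑ p ∈ antidiagonal n,
      (A p.1).eval x / (p.1.factorial : ℝ) * coeff p.2 ((exp ℝ - 1) ^ k) := by
  simp_rw [coeff_exp_sub_one_pow, mul_sum]
  rw [sum_comm, fdiffP, Polynomial.eval_finsetSum, sum_div]
  refine sum_congr rfl fun j _ => ?_
  have h := hA.eval_add n x j
  simp only [Polynomial.eval_smul, Polynomial.eval_comp, Polynomial.eval_add, Polynomial.eval_X,
    Polynomial.eval_C, smul_eq_mul]
  rw [mul_div_assoc, h, mul_sum]
  refine sum_congr rfl fun p _ => ?_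
  ring

open PowerSeries in
theorem IsAppell.eval_LP {A : ℕ → Polynomial ℝ} (hA : IsAppell A) (u : ℕ → ℝ) (n : ℕ) (x : ℝ) :
    (LP u A n).eval x / (n.factorial : ℝ) = ∑ p ∈ antidiagonal n,
      (A p.1).eval x / (p.1.factorial : ℝ) *
        ∑' k, u k / (k.factorial : ℝ) * coeff p.2 ((exp ℝ - 1) ^ k) := by
  have h (p : ℕ × ℕ) (hp : p ∈ antidiagonal n) :
      ∑' k, u k / (k.factorial : ℝ) * coeff p.2 ((exp ℝ - 1) ^ k)
        = ∑ k ∈ range (n + 1), u k / (k.factorial : ℝ) * coeff p.2 ((exp ℝ - 1) ^ k) := by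
    refine tsum_eq_sum fun k hk => ?_
    have := mem_antidiagonal.1 hp
    rw [coeff_exp_sub_one_pow_of_lt (by rw [mem_range] at hk; omega), mul_zero]
  rw [sum_congr rfl fun p hp => by rw [h p hp, mul_sum], sum_comm, LP, Polynomial.eval_finsetSum,
    sum_div]
  refine sum_congr rfl fun k _ => ?_
  rw [Polynomial.eval_smul, smul_eq_mul, mul_div_assoc, hA.eval_fdiffP, mul_sum]
  refine sum_congr rfl fun p _ => ?_
  ring

/-- The exponential generating function of the values `A n x` factors as
`A(z) e^{xz}`. -/
theorem IsAppell.summable_and_tsum_eval {A : ℕ → Polynomial ℝ} (hA : IsAppell A) (x : ℝ) {z : ℂ}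
    (hz : Summable fun n => ‖(((A n).eval 0 : ℝ) : ℂ) * z ^ n / (n.factorial : ℕ)‖) :
    (Summable fun n => ‖(((A n).eval x : ℝ) : ℂ) * z ^ n / (n.factorial : ℕ)‖) ∧
      ∑' n : ℕ, (((A n).eval x : ℝ) : ℂ) * z ^ n / (n.factorial : ℕ)
        = (∑' n : ℕ, (((A n).eval 0 : ℝ) : ℂ) * z ^ n / (n.factorial : ℕ)) *
          Complex.exp (x * z) := by
  have hexp := Complex.hasSum_pow_div_factorial (x * z)
  have h (n : ℕ) : (((A n).eval x : ℝ) : ℂ) * z ^ n / (n.factorial : ℕ)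
      = ∑ p ∈ antidiagonal n, (((A p.1).eval 0 : ℝ) : ℂ) * z ^ p.1 / (p.1.factorial : ℕ) *
        ((x * z) ^ p.2 / (p.2.factorial : ℂ)) := by
    have := congrArg (fun y : ℝ => (y : ℂ) * z ^ n) (hA.eval_add n 0 x)
    simp only [zero_add] at this
    push_cast at this
    rw [mul_div_right_comm, this, sum_mul]
    refine sum_congr rfl fun p hp => ?_
    rw [← mem_antidiagonal.1 hp]
    ring
  refine ⟨?_, ?_⟩
  · exact (summable_norm_sum_mul_antidiagonal_of_summable_norm hz hexp.summable.norm).congr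
      fun n => by rw [h]
  · rw [tsum_congr h, ← hexp.tsum_eq]
    exact (tsum_mul_tsum_eq_tsum_sum_antidiagonal_of_summable_norm hz hexp.summable.norm).symm

open PowerSeries in
/-- Expansion of `∑ u_k (e^z - 1)^k / k!` in powers of `z`. -/
theorem summable_and_tsum_exp_sub_one {u : ℕ → ℝ} {z : ℂ}
    (hu : Summable fun k => |u k| * (Real.exp ‖z‖ - 1) ^ k / (k.factorial : ℝ)) :
    (Summable fun m => ‖((∑' k, u k / (k.factorial : ℝ) *
        coeff m ((exp ℝ - 1) ^ k) : ℝ) : ℂ) * z ^ m‖) ∧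
      ∑' m, ((∑' k, u k / (k.factorial : ℝ) * coeff m ((exp ℝ - 1) ^ k) : ℝ) : ℂ) * z ^ m
        = ∑' k : ℕ, ((u k : ℝ) : ℂ) * (Complex.exp z - 1) ^ k / (k.factorial : ℕ) := by
  let f : ℕ × ℕ → ℂ := fun p =>
    (u p.1 : ℂ) / (p.1.factorial : ℂ) * (((coeff p.2 ((exp ℝ - 1) ^ p.1) : ℝ) : ℂ) * z ^ p.2)
  have hrow (k : ℕ) : HasSum (fun m => ‖f (k, m)‖)
      (|u k| / (k.factorial : ℝ) * (Real.exp ‖z‖ - 1) ^ k) := by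
    have h (m : ℕ) : ‖f (k, m)‖
        = |u k| / (k.factorial : ℝ) * (coeff m ((exp ℝ - 1) ^ k) * ‖z‖ ^ m) := by
      simp [f, abs_of_nonneg (coeff_exp_sub_one_pow_nonneg k m)]
    simp_rw [h]
    exact (hasSum_exp_sub_one_pow_real k ‖z‖).mul_left _
  have hf : Summable fun p => ‖f p‖ := by
    rw [summable_prod_of_nonneg fun p => norm_nonneg _]
    exact ⟨fun k => (hrow k).summable,
      hu.congr fun k => by rw [(hrow k).tsum_eq, mul_div_right_comm]⟩
  have hcol (m : ℕ) :
      ((∑' k, u k / (k.factorial : ℝ) * coeff m ((exp ℝ - 1) ^ k) : ℝ) : ℂ) * z ^ m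
        = ∑' k, f (k, m) := by
    rw [Complex.ofReal_tsum, ← tsum_mul_right]
    refine tsum_congr fun k => ?_
    simp only [f]
    push_cast
    ring
  have hswap : Summable fun p : ℕ × ℕ => ‖f p.swap‖ := hf.prod_symm
  refine ⟨hswap.prod.of_nonneg_of_le (fun m => norm_nonneg _) fun m => ?_, ?_⟩
  · rw [hcol]
    exact norm_tsum_le_tsum_norm (hswap.prod_factor m)
  · refine (tsum_congr hcol).trans ((Summable.tsum_comm (f := fun k m => f (k, m))
      hf.of_norm).trans (tsum_congr fun k => ?_))
    simp only [f]
    rw [tsum_mul_left, (hasSum_exp_sub_one_pow k z).tsum_eq, mul_div_right_comm]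

/-- generating function of the forward difference transformation `L_u A`. -/
theorem generatingFunction_LP (A : ℕ → Polynomial ℝ) (hA : IsAppell A)
    (r : ℝ) (hr : 0 < r) (hAr : Summable fun n => |(A n).eval 0| * r ^ n / (n.factorial : ℝ))
    (u : ℕ → ℝ) (hu0 : u 0 ≠ 0)
    (s : ℝ) (hs : 0 < s) (hus : Summable fun n => |u n| * s ^ n / (n.factorial : ℝ))
    (t : ℝ) (ht : 0 < t) (hts : t * Real.exp t = s)
    (x : ℝ) (z : ℂ) (hz : ‖z‖ ≤ min r t) :
    Summable (fun n => ‖(((LP u A n).eval x : ℝ) : ℂ) * z ^ n / (n.factorial : ℕ)‖) ∧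
    Summable (fun n => ‖(((A n).eval 0 : ℝ) : ℂ) * z ^ n / (n.factorial : ℕ)‖) ∧
    Summable (fun k => ‖((u k : ℝ) : ℂ) * (Complex.exp z - 1) ^ k / (k.factorial : ℕ)‖) ∧
    ∑' n : ℕ, (((LP u A n).eval x : ℝ) : ℂ) * z ^ n / (n.factorial : ℕ)
      = (∑' n : ℕ, (((A n).eval 0 : ℝ) : ℂ) * z ^ n / (n.factorial : ℕ)) *
          (∑' k : ℕ, ((u k : ℝ) : ℂ) * (Complex.exp z - 1) ^ k / (k.factorial : ℕ)) *
          Complex.exp (x * z) := by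
  have hzr : ‖z‖ ≤ r := hz.trans (min_le_left r t)
  have hzt : ‖z‖ ≤ t := hz.trans (min_le_right r t)
  have hexp : Real.exp ‖z‖ - 1 ≤ s := by
    have h₁ : Real.exp ‖z‖ ≤ Real.exp t := Real.exp_le_exp.2 hzt
    have h₂ : (1 - t) * Real.exp t ≤ 1 := by
      calc (1 - t) * Real.exp t ≤ Real.exp (-t) * Real.exp t := by
            gcongr
            linarith [Real.add_one_le_exp (-t)]
        _ = 1 := by rw [← Real.exp_add]; simp
    linarith
  have hexp₀ : 0 ≤ Real.exp ‖z‖ - 1 := by linarith [Real.add_one_le_exp ‖z‖, norm_nonneg z]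
  have hu : Summable fun k => |u k| * (Real.exp ‖z‖ - 1) ^ k / (k.factorial : ℝ) :=
    hus.of_nonneg_of_le (fun k => by positivity) fun k => by gcongr
  have hA₀ : Summable fun n => ‖(((A n).eval 0 : ℝ) : ℂ) * z ^ n / (n.factorial : ℕ)‖ := by
    refine hAr.of_nonneg_of_le (fun n => norm_nonneg _) fun n => ?_
    simp only [norm_div, norm_mul, norm_pow, Complex.norm_real, Real.norm_eq_abs,
      Complex.norm_natCast]
    gcongr
  have hu' : Summable fun k =>
      ‖((u k : ℝ) : ℂ) * (Complex.exp z - 1) ^ k / (k.factorial : ℕ)‖ := by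
    refine hu.of_nonneg_of_le (fun k => norm_nonneg _) fun k => ?_
    rw [norm_div, norm_mul, Complex.norm_real, Real.norm_eq_abs, Complex.norm_natCast]
    gcongr
    exact norm_exp_sub_one_pow_le k z
  obtain ⟨hAx, hAx_tsum⟩ := hA.summable_and_tsum_eval x hA₀
  obtain ⟨hb, hb_tsum⟩ := summable_and_tsum_exp_sub_one hu
  have hLP (n : ℕ) : (((LP u A n).eval x : ℝ) : ℂ) * z ^ n / (n.factorial : ℕ)
      = ∑ p ∈ antidiagonal n, (((A p.1).eval x : ℝ) : ℂ) * z ^ p.1 / (p.1.factorial : ℕ) *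
        (((∑' k, u k / (k.factorial : ℝ) *
          PowerSeries.coeff p.2 ((PowerSeries.exp ℝ - 1) ^ k) : ℝ) : ℂ) * z ^ p.2) := by
    have h := congrArg (fun y : ℝ => (y : ℂ) * z ^ n) (hA.eval_LP u n x)
    simp only [Complex.ofReal_div, Complex.ofReal_natCast, Complex.ofReal_sum,
      Complex.ofReal_mul _ (tsum _)] at h
    rw [mul_div_right_comm, h, sum_mul]
    refine sum_congr rfl fun p hp => ?_
    rw [← mem_antidiagonal.1 hp]
    ring
  refine ⟨?_, hA₀, hu', ?_⟩
  · exact (summable_norm_sum_mul_antidiagonal_of_summable_norm hAx hb).congr fun n => by rw [hLP]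
  · rw [tsum_congr hLP, mul_right_comm, ← hAx_tsum, ← hb_tsum]
    exact (tsum_mul_tsum_eq_tsum_sum_antidiagonal_of_summable_norm hAx hb).symm
end

section
/- Let A be an Appell sequence and let u = (u_n)_{n≥0} be a real sequence with u_0 ≠ 0. Then L_u A is again an Appell sequence: (L_u A)_0 is the nonzero constant u_0·A_0(0), and for every n ≥ 1 the polynomial derivative satisfies ((L_u A)_n)'(x) = n·(L_u A)_{n−1}(x) for all real x. -/
open Finset MeasureTheory

theorem derivative_fdiffP (k : ℕ) (p : Polynomial ℝ) :
    (fdiffP k p).derivative = fdiffP k p.derivative := by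
  simp [fdiffP, Polynomial.derivative_comp]

theorem fdiffP_smul (k : ℕ) (c : ℝ) (p : Polynomial ℝ) :
    fdiffP k (c • p) = c • fdiffP k p := by
  simp only [fdiffP, Polynomial.smul_comp, Finset.smul_sum, smul_comm c]

theorem fdiffP_eq_zero_of_natDegree_lt {k : ℕ} {p : Polynomial ℝ} (h : p.natDegree < k) :
    fdiffP k p = 0 := by
  refine Polynomial.funext fun x => ?_
  have hx := congrFun (Polynomial.fwdDiff_iter_eq_zero_of_degree_lt h) x
  rw [fwdDiff_iter_eq_sum_shift] at hx
  simpa [fdiffP, Polynomial.eval_finsetSum, mul_comm] using hx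

theorem IsAppell.derivative_LP {A : ℕ → Polynomial ℝ} (hA : IsAppell A) (u : ℕ → ℝ) (n : ℕ) :
    (LP u A (n + 1)).derivative = ((n : ℝ) + 1) • LP u A n := by
  have hterm (k : ℕ) : (fdiffP k (A (n + 1))).derivative = ((n : ℝ) + 1) • fdiffP k (A n) := by
    rw [derivative_fdiffP, hA.2.2, fdiffP_smul]
  have htop : fdiffP (n + 1) (A n) = 0 :=
    fdiffP_eq_zero_of_natDegree_lt (Nat.lt_succ_of_le (hA.natDegree_le n))
  simp only [LP, Polynomial.derivative_sum, Polynomial.derivative_smul, hterm]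
  rw [Finset.sum_range_succ, htop, smul_zero, smul_zero, add_zero, Finset.smul_sum]
  exact Finset.sum_congr rfl fun k _ => smul_comm _ _ _

/-- `L_u A` is again an Appell sequence. -/
theorem LP_isAppell (A : ℕ → Polynomial ℝ) (hA : IsAppell A) (u : ℕ → ℝ) (hu0 : u 0 ≠ 0) :
    LP u A 0 = Polynomial.C (u 0 * (A 0).eval 0) ∧ u 0 * (A 0).eval 0 ≠ 0 ∧
      ∀ n : ℕ, ∀ x : ℝ,
        ((LP u A (n + 1)).derivative).eval x = ((n : ℝ) + 1) * (LP u A n).eval x := by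
  refine ⟨?_, mul_ne_zero hu0 hA.1, fun n x => ?_⟩
  · obtain ⟨c, hc⟩ := hA.2.1
    simp [LP, fdiffP, hc, Polynomial.smul_C]
  · rw [hA.derivative_LP, Polynomial.eval_smul, smul_eq_mul]
end

section
/- Let u = (u_n)_{n≥0} and v = (v_n)_{n≥0} be real sequences whose binomial convolution is the identity, i.e. (u×v)_0 = 1 and (u×v)_n = 0 for all n ≥ 1. Then for every Appell sequence A, every n ≥ 0 and every real x, (L_v (L_u A))_n(x) = A_n(x) = (L_u (L_v A))_n(x); consequently the map A ↦ L_u A is a bijection of the set of Appell sequences onto itself with inverse A ↦ L_v A. -/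
open Finset MeasureTheory

open Polynomial in
/-- The forward difference `p(x) ↦ p(x + 1) - p(x)` as a linear operator on real polynomials. -/
noncomputable def fdiffEnd : Module.End ℝ ℝ[X] := taylor 1 - 1

theorem fdiffP_eq_fdiffEnd_pow (k : ℕ) (p : Polynomial ℝ) : fdiffP k p = (fdiffEnd ^ k) p := by
  have htaylor (j : ℕ) : ((Polynomial.taylor (1 : ℝ) : Module.End ℝ (Polynomial ℝ)) ^ j) p =
      p.comp (Polynomial.X + Polynomial.C (j : ℝ)) := by
    induction j with
    | zero => simp
    | succ j ih =>
      rw [pow_succ', Module.End.mul_apply, ih, ← Polynomial.taylor_apply,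
        ← Polynomial.taylor_apply, Polynomial.taylor_taylor]
      push_cast
      rw [add_comm]
  have hcomm : Commute (S := Module.End ℝ (Polynomial ℝ)) (Polynomial.taylor 1) (-1) :=
    LinearMap.ext fun q => by simp
  have hneg (m : ℕ) : ((-1 : Module.End ℝ (Polynomial ℝ)) ^ m) p = (-1 : ℝ) ^ m • p := by
    induction m with
    | zero => simp
    | succ m ih => rw [pow_succ', Module.End.mul_apply, ih]; simp [pow_succ]
  rw [fdiffEnd, sub_eq_add_neg, hcomm.add_pow, LinearMap.sum_apply, fdiffP]
  refine Finset.sum_congr rfl fun j _ => ?_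
  rw [← htaylor, ← nsmul_eq_mul', LinearMap.smul_apply, ← Nat.cast_smul_eq_nsmul ℝ,
    Module.End.mul_apply, hneg, map_smul, smul_smul]

theorem eval_fdiffEnd_pow (k : ℕ) (p : Polynomial ℝ) (x : ℝ) :
    ((fdiffEnd ^ k) p).eval x = (fwdDiff 1)^[k] (fun y => p.eval y) x := by
  induction k generalizing x with
  | zero => simp
  | succ k ih =>
    rw [pow_succ', Module.End.mul_apply, Function.iterate_succ_apply', fwdDiff, ← ih, ← ih]
    rw [← Polynomial.taylor_eval, ← Polynomial.eval_sub]
    rfl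

theorem fdiffEnd_pow_eq_zero {k : ℕ} {p : Polynomial ℝ} (h : p.natDegree < k) :
    (fdiffEnd ^ k) p = 0 := by
  refine Polynomial.funext fun x => ?_
  rw [eval_fdiffEnd_pow, Polynomial.eval_zero]
  exact congrFun (Polynomial.fwdDiff_iter_eq_zero_of_degree_lt h) x

theorem derivative_fdiffEnd_pow (k : ℕ) (p : Polynomial ℝ) :
    ((fdiffEnd ^ k) p).derivative = (fdiffEnd ^ k) p.derivative := by
  induction k with
  | zero => simp
  | succ k ih =>
    rw [pow_succ', Module.End.mul_apply, Module.End.mul_apply, ← ih]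
    simp [fdiffEnd, Polynomial.taylor_apply, Polynomial.derivative_comp]

theorem LP_eq_sum_fdiffEnd (u : ℕ → ℝ) (A : ℕ → Polynomial ℝ) (n : ℕ) :
    LP u A n =
      ∑ k ∈ Finset.range (n + 1), (u k / (k.factorial : ℝ)) • (fdiffEnd ^ k) (A n) := by
  simp only [LP, fdiffP_eq_fdiffEnd_pow]

theorem isAppell_LP {A : ℕ → Polynomial ℝ} (hA : IsAppell A) {u : ℕ → ℝ} (hu : u 0 ≠ 0) :
    IsAppell (LP u A) := by
  have hdeg := hA.natDegree_le
  obtain ⟨h0, ⟨c, hc⟩, hder⟩ := hA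
  have hzero : LP u A 0 = u 0 • A 0 := by simp [LP_eq_sum_fdiffEnd]
  refine ⟨?_, ⟨u 0 * c, ?_⟩, fun n => ?_⟩
  · rw [hzero, Polynomial.eval_smul, smul_eq_mul]
    exact mul_ne_zero hu h0
  · rw [hzero, hc, Polynomial.smul_C, smul_eq_mul]
  · rw [LP_eq_sum_fdiffEnd, LP_eq_sum_fdiffEnd, Polynomial.derivative_sum, Finset.smul_sum]
    simp only [derivative_fdiffEnd_pow, hder, map_smul]
    rw [Finset.sum_range_succ, fdiffEnd_pow_eq_zero (Nat.lt_succ_of_le (hdeg n)), smul_zero,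
      smul_zero, add_zero]
    exact Finset.sum_congr rfl fun k _ => smul_comm _ _ _

/-- The composition of two forward difference transformations is the transformation attached to
the binomial convolution. -/
theorem LP_LP {A : ℕ → Polynomial ℝ} (hA : IsAppell A) (u v : ℕ → ℝ) :
    LP u (LP v A) = LP (bconv u v) A := by
  funext n
  rw [LP_eq_sum_fdiffEnd, LP_eq_sum_fdiffEnd, LP_eq_sum_fdiffEnd]
  set f : ℕ → ℕ → Polynomial ℝ := fun i j =>
    ((u i / (i.factorial : ℝ)) * (v j / (j.factorial : ℝ))) • (fdiffEnd ^ (i + j)) (A n) with hf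
  have hleft (i : ℕ) (hi : i ∈ Finset.range (n + 1)) : (u i / (i.factorial : ℝ)) • (fdiffEnd ^ i)
      (∑ j ∈ Finset.range (n + 1), (v j / (j.factorial : ℝ)) • (fdiffEnd ^ j) (A n)) =
      ∑ j ∈ Finset.range (n + 1 - i), f i j := by
    rw [map_sum, Finset.smul_sum]
    simp only [map_smul, smul_smul, ← Module.End.mul_apply, ← pow_add]
    refine (Finset.sum_subset (Finset.range_mono (Nat.sub_le _ _)) fun j _ hj => ?_).symm
    rw [Finset.mem_range] at hi hj
    have := hA.natDegree_le n
    rw [fdiffEnd_pow_eq_zero (by omega), smul_zero]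
  rw [Finset.sum_congr rfl hleft, ← Finset.sum_range_diag_flip]
  refine Finset.sum_congr rfl fun m _ => ?_
  rw [bconv, Finset.sum_div, Finset.sum_smul]
  refine Finset.sum_congr rfl fun k hk => ?_
  have hkm : k ≤ m := Nat.lt_succ_iff.mp (Finset.mem_range.mp hk)
  simp only [hf, Nat.add_sub_cancel' hkm]
  congr 1
  rw [Nat.cast_choose ℝ hkm]
  field_simp

theorem bconv_comm (u v : ℕ → ℝ) : bconv u v = bconv v u := by
  funext n
  rw [bconv, ← Finset.sum_range_reflect, bconv]
  refine Finset.sum_congr rfl fun k hk => ?_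
  have hkn : k ≤ n := Nat.lt_succ_iff.mp (Finset.mem_range.mp hk)
  rw [show n + 1 - 1 - k = n - k by omega, Nat.choose_symm hkn, Nat.sub_sub_self hkn]
  ring

theorem LP_eq_self {w : ℕ → ℝ} (h0 : w 0 = 1) (h : ∀ n : ℕ, 1 ≤ n → w n = 0)
    (A : ℕ → Polynomial ℝ) : LP w A = A := by
  funext n
  rw [LP_eq_sum_fdiffEnd, Finset.sum_eq_single_of_mem 0 (by simp)]
  · simp [h0]
  · intro k _ hk
    rw [h k (Nat.one_le_iff_ne_zero.mpr hk), zero_div, zero_smul]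

/-- if `u × v` is the identity for binomial convolution, then `L_u` and `L_v`
are mutually inverse bijections of the set of Appell sequences. -/
theorem LP_inverse (u v : ℕ → ℝ) (huv0 : bconv u v 0 = 1)
    (huv : ∀ n : ℕ, 1 ≤ n → bconv u v n = 0) :
    (∀ A : ℕ → Polynomial ℝ, IsAppell A → ∀ n : ℕ, ∀ x : ℝ,
        (LP v (LP u A) n).eval x = (A n).eval x ∧ (LP u (LP v A) n).eval x = (A n).eval x) ∧
    Set.BijOn (fun A => LP u A) {A : ℕ → Polynomial ℝ | IsAppell A}
      {A : ℕ → Polynomial ℝ | IsAppell A} ∧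
    Set.InvOn (fun A => LP v A) (fun A => LP u A) {A : ℕ → Polynomial ℝ | IsAppell A}
      {A : ℕ → Polynomial ℝ | IsAppell A} := by
  have huv1 : u 0 * v 0 = 1 := by simpa [bconv] using huv0
  have hu : u 0 ≠ 0 := left_ne_zero_of_mul_eq_one huv1
  have hv : v 0 ≠ 0 := right_ne_zero_of_mul_eq_one huv1
  have hvu (A : ℕ → Polynomial ℝ) (hA : IsAppell A) : LP v (LP u A) = A := by
    rw [LP_LP hA, bconv_comm, LP_eq_self huv0 huv]
  have huv' (A : ℕ → Polynomial ℝ) (hA : IsAppell A) : LP u (LP v A) = A := by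
    rw [LP_LP hA, LP_eq_self huv0 huv]
  have hinv : Set.InvOn (fun A => LP v A) (fun A => LP u A) {A : ℕ → Polynomial ℝ | IsAppell A}
      {A : ℕ → Polynomial ℝ | IsAppell A} := ⟨hvu, huv'⟩
  refine ⟨fun A hA n x => ⟨?_, ?_⟩, ?_, hinv⟩
  · rw [hvu A hA]
  · rw [huv' A hA]
  · exact hinv.bijOn (fun A hA => isAppell_LP hA hu) (fun A hA => isAppell_LP hA hv)
end

section
/- For all n ≥ 0 and 0 ≤ k ≤ n, the Stirling number of the second kind satisfies S(n,k) = C(n,k) · ∫_{[0,1]^k} (u_1 + ⋯ + u_k)^{n−k} du_1⋯du_k, where the integral is with respect to Lebesgue measure on the cube [0,1]^k (for k = 0 the integral is interpreted as 1, so S(n,0) = 0^n). -/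
open Finset MeasureTheory

/-- The integral of `(x + u₁ + ⋯ + u_k)^m` over the unit cube `[0,1]^k`. -/
noncomputable def cubeMoment (k m : ℕ) (x : ℝ) : ℝ :=
  ∫ u : Fin k → ℝ in Set.univ.pi fun _ : Fin k => Set.Icc (0 : ℝ) 1, (x + ∑ i, u i) ^ m

theorem integral_Icc_add_pow (m : ℕ) (x : ℝ) :
    ((m : ℝ) + 1) * ∫ t in Set.Icc (0 : ℝ) 1, (t + x) ^ m = (x + 1) ^ (m + 1) - x ^ (m + 1) := by
  rw [integral_Icc_eq_integral_Ioc, ← intervalIntegral.integral_of_le zero_le_one,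
    intervalIntegral.integral_comp_add_right (fun t => t ^ m), integral_pow,
    zero_add, add_comm 1 x]
  field_simp

theorem integrableOn_cube_add_sum_pow (k m : ℕ) (x : ℝ) :
    IntegrableOn (fun u : Fin k → ℝ => (x + ∑ i, u i) ^ m)
      (Set.univ.pi fun _ : Fin k => Set.Icc (0 : ℝ) 1) := by
  refine ContinuousOn.integrableOn_compact (isCompact_univ_pi fun _ => isCompact_Icc) ?_
  fun_prop

theorem cubeMoment_succ (k m : ℕ) (x : ℝ) :
    ((m : ℝ) + 1) * cubeMoment (k + 1) m x =
      cubeMoment k (m + 1) (x + 1) - cubeMoment k (m + 1) x := by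
  set C := Set.univ.pi fun _ : Fin k => Set.Icc (0 : ℝ) 1 with hC
  have hsplit : cubeMoment (k + 1) m x =
      ∫ p : ℝ × (Fin k → ℝ) in Set.Icc (0 : ℝ) 1 ×ˢ C, (p.1 + (x + ∑ i, p.2 i)) ^ m := by
    rw [cubeMoment, ← (volume_preserving_piFinSuccAbove (fun _ : Fin (k + 1) => ℝ)
      0).setIntegral_preimage_emb (MeasurableEquiv.measurableEmbedding _)]
    congr 1
    · congr 1
      ext u
      simp only [hC, Set.mem_preimage, Set.mem_prod, Set.mem_univ_pi, Fin.forall_fin_succ]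
      rfl
    · ext u
      simp [Fin.sum_univ_succ, Fin.tail, add_left_comm]
  have hswap : cubeMoment (k + 1) m x =
      ∫ u in C, ∫ t in Set.Icc (0 : ℝ) 1, (t + (x + ∑ i, u i)) ^ m := by
    rw [hsplit, Measure.volume_eq_prod, ← setIntegral_prod_swap, setIntegral_prod]
    · rfl
    · refine ContinuousOn.integrableOn_compact
        ((isCompact_univ_pi fun _ => isCompact_Icc).prod isCompact_Icc) ?_
      fun_prop
  rw [hswap, ← integral_const_mul]
  simp_rw [integral_Icc_add_pow, add_right_comm x _ (1 : ℝ)]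
  exact integral_sub (integrableOn_cube_add_sum_pow k (m + 1) (x + 1))
    (integrableOn_cube_add_sum_pow k (m + 1) x)

theorem fwdDiff_iter_pow_eq_cubeMoment (k m : ℕ) (x : ℝ) :
    (fwdDiff (1 : ℝ))^[k] (fun y : ℝ => y ^ (m + k)) x =
      ((m + k).descFactorial k : ℝ) * cubeMoment k m x := by
  induction k generalizing m x with
  | zero => simp [cubeMoment, measureReal_def, Real.volume_Icc_pi]
  | succ k ih =>
    rw [Function.iterate_succ_apply', fwdDiff, ← add_assoc, add_right_comm m k 1, ih, ih,
      ← mul_sub, ← cubeMoment_succ, Nat.descFactorial_succ]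
    have h : m + 1 + k - k = m + 1 := by omega
    rw [h]
    push_cast
    ring

theorem stirling2_eq_fwdDiff_iter (n k : ℕ) :
    stirling2 n k = (fwdDiff (1 : ℝ))^[k] (fun y : ℝ => y ^ n) 0 / (k.factorial : ℝ) := by
  rw [stirling2, fwdDiff_iter_eq_sum_shift, one_div_mul_eq_div]
  simp [zsmul_eq_mul]

/-- probabilistic (integral) representation of the Stirling numbers of the
second kind: `S(n,k) = C(n,k) ∫_{[0,1]^k} (u₁+⋯+u_k)^{n-k}`. -/
theorem stirling2_integral_repr (n k : ℕ) (hk : k ≤ n) :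
    stirling2 n k = (n.choose k : ℝ) *
      ∫ u : Fin k → ℝ in Set.univ.pi fun _ : Fin k => Set.Icc (0 : ℝ) 1,
        (∑ i, u i) ^ (n - k) := by
  obtain ⟨m, rfl⟩ := Nat.exists_eq_add_of_le' hk
  rw [stirling2_eq_fwdDiff_iter, fwdDiff_iter_pow_eq_cubeMoment,
    Nat.descFactorial_eq_factorial_mul_choose]
  have hf : (k.factorial : ℝ) ≠ 0 := by exact_mod_cast k.factorial_ne_zero
  simp only [cubeMoment, zero_add, Nat.add_sub_cancel, Nat.cast_mul]
  field_simp
end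

section
/- For all n ≥ 0 and 0 ≤ k ≤ n, the signed Stirling number of the first kind satisfies s(n,k) = (−1)^{n−k} C(n,k) · ∫_{[0,1]^k} ∫_{[0,∞)^k} (u_1 t_1 + ⋯ + u_k t_k)^{n−k} e^{−(t_1+⋯+t_k)} dt_1⋯dt_k du_1⋯du_k (for k = 0 the integral is interpreted as 1, so s(n,0) = 0 for n ≥ 1 and s(0,0) = 1). -/
open Finset MeasureTheory

namespace StirlingIntegral

/-- The power series `∑ X^m / (m + 1) = -log (1 - X) / X`. -/
noncomputable def logSeries : PowerSeries ℝ :=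
  PowerSeries.mk fun m => 1 / ((m : ℝ) + 1)

open PowerSeries in
theorem one_sub_X_mul_derivative : (1 - X) * d⁄dX ℝ (X * logSeries) = 1 := by
  have h : d⁄dX ℝ (X * logSeries) = PowerSeries.mk 1 := by
    ext n
    rw [coeff_derivative, coeff_succ_X_mul, logSeries, coeff_mk, coeff_mk, Pi.one_apply,
      one_div_mul_cancel (by positivity)]
  rw [h, mul_comm, mk_one_mul_one_sub_eq_one]

open PowerSeries in
theorem coeff_X_mul_logSeries_pow_succ (n k : ℕ) :
    ((n : ℝ) + 1) * coeff (n + 1) ((X * logSeries) ^ (k + 1)) =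
      n * coeff n ((X * logSeries) ^ (k + 1)) +
        ((k : ℝ) + 1) * coeff n ((X * logSeries) ^ k) := by
  have h : d⁄dX ℝ ((X * logSeries) ^ (k + 1)) =
      X * d⁄dX ℝ ((X * logSeries) ^ (k + 1)) + C ((k : ℝ) + 1) * (X * logSeries) ^ k := by
    have h2 : d⁄dX ℝ ((X * logSeries) ^ (k + 1)) =
        C ((k : ℝ) + 1) * (X * logSeries) ^ k * d⁄dX ℝ (X * logSeries) := by
      rw [Derivation.leibniz_pow]
      simp [nsmul_eq_mul, mul_assoc]
    rw [h2]
    linear_combination (C ((k : ℝ) + 1) * (X * logSeries) ^ k) * one_sub_X_mul_derivative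
  have hn := congrArg (coeff n) h
  rw [map_add, coeff_C_mul, coeff_derivative] at hn
  cases n with
  | zero =>
    rw [coeff_zero_X_mul] at hn
    push_cast at hn ⊢
    linear_combination hn
  | succ n =>
    rw [coeff_succ_X_mul, coeff_derivative] at hn
    push_cast at hn ⊢
    linear_combination hn

theorem stirling1_zero_left (k : ℕ) : stirling1 0 k = if k = 0 then 1 else 0 := by
  simp [stirling1, Polynomial.coeff_one]

theorem stirling1_succ_zero (n : ℕ) : stirling1 (n + 1) 0 = -n * stirling1 n 0 := by
  simp [stirling1, Finset.prod_range_succ, mul_comm]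

theorem stirling1_succ_succ (n k : ℕ) :
    stirling1 (n + 1) (k + 1) = stirling1 n k - n * stirling1 n (k + 1) := by
  rw [stirling1, Finset.prod_range_succ, mul_comm, sub_mul, Polynomial.coeff_sub,
    Polynomial.coeff_X_mul, Polynomial.coeff_C_mul, stirling1, stirling1]

open PowerSeries in
theorem stirling1_eq_coeff (n k : ℕ) :
    stirling1 n k = (-1 : ℝ) ^ (n + k) * ((n.factorial : ℝ) / k.factorial) *
      coeff n ((X * logSeries) ^ k) := by
  induction n generalizing k with
  | zero =>
    rw [stirling1_zero_left]
    cases k <;> simp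
  | succ n ih =>
    cases k with
    | zero =>
      rw [stirling1_succ_zero, ih]
      cases n <;> simp [coeff_one]
    | succ k =>
      rw [stirling1_succ_succ, ih, ih]
      have h := coeff_X_mul_logSeries_pow_succ n k
      have hk : (k.factorial : ℝ) ≠ 0 := by positivity
      have hk' : (k : ℝ) + 1 ≠ 0 := by positivity
      rw [Nat.factorial_succ, Nat.factorial_succ]
      push_cast
      field_simp
      linear_combination (-(-1 : ℝ) ^ (n + k)) * h

theorem integrable_pow_mul_exp_neg (a : ℕ) :
    Integrable (fun t : ℝ => t ^ a * Real.exp (-t)) (volume.restrict (Set.Ici 0)) := by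
  have h := Real.GammaIntegral_convergent (s := (a : ℝ) + 1) (by positivity)
  rw [Measure.restrict_congr_set Ioi_ae_eq_Ici.symm]
  simpa [mul_comm, IntegrableOn] using h

theorem integral_pow_mul_exp_neg (a : ℕ) :
    ∫ t : ℝ in Set.Ici 0, t ^ a * Real.exp (-t) = a.factorial := by
  rw [integral_Ici_eq_integral_Ioi, ← Real.Gamma_nat_eq_factorial,
    Real.Gamma_eq_integral (by positivity)]
  simp [mul_comm]

theorem integral_Icc_pow (a : ℕ) :
    ∫ u : ℝ in Set.Icc 0 1, u ^ a = 1 / ((a : ℝ) + 1) := by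
  rw [integral_Icc_eq_integral_Ioc, ← intervalIntegral.integral_of_le zero_le_one, integral_pow]
  simp

theorem sum_mul_pow_mul_exp_neg {k : ℕ} (m : ℕ) (u t : Fin k → ℝ) :
    (∑ i, u i * t i) ^ m * Real.exp (-∑ i, t i) =
      ∑ a ∈ piAntidiag univ m, (Nat.multinomial univ a * ∏ i, u i ^ a i) *
        ∏ i, (t i ^ a i * Real.exp (-t i)) := by
  rw [Finset.sum_pow_eq_sum_piAntidiag, Finset.sum_mul, ← Finset.sum_neg_distrib, Real.exp_sum]
  refine Finset.sum_congr rfl fun a _ => ?_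
  simp only [mul_pow, Finset.prod_mul_distrib]
  ring

theorem integral_sum_mul_pow_mul_exp_neg {k : ℕ} (m : ℕ) (u : Fin k → ℝ) :
    ∫ t : Fin k → ℝ in Set.univ.pi fun _ : Fin k => Set.Ici (0 : ℝ),
        (∑ i, u i * t i) ^ m * Real.exp (-∑ i, t i) =
      ∑ a ∈ piAntidiag univ m, (m.factorial : ℝ) * ∏ i, u i ^ a i := by
  simp_rw [sum_mul_pow_mul_exp_neg]
  rw [volume_pi, Measure.restrict_pi_pi, integral_finsetSum]
  · refine Finset.sum_congr rfl fun a ha => ?_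
    rw [integral_const_mul,
      integral_fintype_prod_eq_prod (fun i (t : ℝ) => t ^ a i * Real.exp (-t))]
    simp_rw [integral_pow_mul_exp_neg]
    rw [← (mem_piAntidiag.1 ha).1, ← Nat.multinomial_spec]
    push_cast
    ring
  · intro a _
    exact (Integrable.fintype_prod_dep (f := fun i (t : ℝ) => t ^ a i * Real.exp (-t))
      fun i => integrable_pow_mul_exp_neg (a i)).const_mul _

theorem coeff_logSeries_pow (k m : ℕ) :
    PowerSeries.coeff m (logSeries ^ k) =
      ∑ a ∈ piAntidiag (univ : Finset (Fin k)) m, ∏ i, 1 / ((a i : ℝ) + 1) := by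
  have h : logSeries ^ k = ∏ _i : Fin k, logSeries := by simp
  rw [h, PowerSeries.coeff_prod]
  refine Finset.sum_equiv Finsupp.equivFunOnFinite (by simp) fun a _ => ?_
  simp [logSeries]

theorem integral_integral_sum_mul_pow_mul_exp_neg (k m : ℕ) :
    ∫ u : Fin k → ℝ in Set.univ.pi fun _ : Fin k => Set.Icc (0 : ℝ) 1,
        ∫ t : Fin k → ℝ in Set.univ.pi fun _ : Fin k => Set.Ici (0 : ℝ),
          (∑ i, u i * t i) ^ m * Real.exp (-∑ i, t i) =
      m.factorial * PowerSeries.coeff m (logSeries ^ k) := by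
  simp_rw [integral_sum_mul_pow_mul_exp_neg]
  rw [volume_pi, Measure.restrict_pi_pi, integral_finsetSum, coeff_logSeries_pow, Finset.mul_sum]
  · refine Finset.sum_congr rfl fun a _ => ?_
    rw [integral_const_mul, integral_fintype_prod_eq_prod (fun i (u : ℝ) => u ^ a i)]
    simp_rw [integral_Icc_pow]
  · intro a _
    exact (Integrable.fintype_prod_dep (f := fun i (u : ℝ) => u ^ a i)
      fun i => (continuous_pow (a i)).integrableOn_Icc).const_mul _

end StirlingIntegral

/-- probabilistic (integral) representation of the signed Stirling numbers of
the first kind: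
`s(n,k) = (-1)^(n-k) C(n,k) ∫_{[0,1]^k} ∫_{[0,∞)^k} (∑ uᵢtᵢ)^{n-k} e^{-∑ tᵢ}`. -/
theorem stirling1_integral_repr (n k : ℕ) (hk : k ≤ n) :
    stirling1 n k = (-1 : ℝ) ^ (n - k) * (n.choose k : ℝ) *
      ∫ u : Fin k → ℝ in Set.univ.pi fun _ : Fin k => Set.Icc (0 : ℝ) 1,
        ∫ t : Fin k → ℝ in Set.univ.pi fun _ : Fin k => Set.Ici (0 : ℝ),
          (∑ i, u i * t i) ^ (n - k) * Real.exp (-∑ i, t i) := by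
  rw [StirlingIntegral.integral_integral_sum_mul_pow_mul_exp_neg,
    StirlingIntegral.stirling1_eq_coeff, mul_pow, PowerSeries.coeff_X_pow_mul', if_pos hk,
    Nat.cast_choose ℝ hk]
  obtain ⟨m, rfl⟩ := Nat.exists_eq_add_of_le hk
  have hs : (-1 : ℝ) ^ (k + m + k) = (-1) ^ m := by
    rw [show k + m + k = m + 2 * k by ring, pow_add, pow_mul]
    simp
  rw [Nat.add_sub_cancel_left, hs]
  field_simp
end

section
/- Let A be an Appell sequence and define a_n = Σ_{k=0}^n s(n,k) A_k(0). Then for every n ≥ 0 and every real x, A_n(x) = Σ_{k=0}^n (a_k/k!) Δ^k I_n(x), and moreover (a_n)_{n≥0} is the unique real sequence with this property; equivalently, A_n(0) = Σ_{k=0}^n S(n,k) a_k for all n. -/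
open Finset MeasureTheory

open Polynomial in
/-- The falling factorial as the product defining the Stirling numbers of the first kind. -/
theorem descPochhammer_eq_prod_X_sub_C (n : ℕ) :
    descPochhammer ℝ n = ∏ i ∈ range n, (X - C (i : ℝ)) := by
  induction n with
  | zero => simp
  | succ n ih => rw [descPochhammer_succ_right, prod_range_succ, ih, map_natCast]

theorem stirling1_eq_coeff_descPochhammer (n k : ℕ) :
    stirling1 n k = (descPochhammer ℝ n).coeff k := by
  rw [stirling1, descPochhammer_eq_prod_X_sub_C]

theorem stirling1_eq_zero_of_lt {n k : ℕ} (h : n < k) : stirling1 n k = 0 := by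
  rw [stirling1_eq_coeff_descPochhammer]
  exact Polynomial.coeff_eq_zero_of_natDegree_lt (by rwa [descPochhammer_natDegree])

theorem fdiff_eq_fwdDiff_iter (k : ℕ) (f : ℝ → ℝ) (x : ℝ) :
    fdiff k f x = (fwdDiff 1)^[k] f x := by
  simp [fdiff, fwdDiff_iter_eq_sum_shift, mul_comm]

theorem fdiff_pow_eq_zero_of_lt {n k : ℕ} (h : n < k) (x : ℝ) :
    fdiff k (fun y => y ^ n) x = 0 := by
  rw [fdiff_eq_fwdDiff_iter, fwdDiff_iter_pow_eq_zero_of_lt h, Pi.zero_apply]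

theorem fdiff_pow_self (n : ℕ) (x : ℝ) : fdiff n (fun y => y ^ n) x = n.factorial := by
  rw [fdiff_eq_fwdDiff_iter, fwdDiff_iter_eq_factorial]
  rfl

theorem stirling2_eq_fdiff_div (n k : ℕ) :
    stirling2 n k = fdiff k (fun y => y ^ n) 0 / (k.factorial : ℝ) := by
  simp only [stirling2, fdiff, zero_add]
  rw [one_div, div_eq_inv_mul]
  congr 1
  exact sum_congr rfl fun j _ => by ring

open Polynomial in
/-- Newton's expansion of `(X + x) ^ n` in falling factorials. -/
theorem X_add_C_pow_eq_sum_fdiff (n : ℕ) (x : ℝ) :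
    (X + C x) ^ n = ∑ k ∈ range (n + 1),
      C (fdiff k (fun y => y ^ n) x / (k.factorial : ℝ)) * descPochhammer ℝ k := by
  refine eq_of_infinite_eval_eq _ _
    ((Set.infinite_range_of_injective Nat.cast_injective).mono ?_)
  rintro _ ⟨m, rfl⟩
  have newton := shift_eq_sum_fwdDiff_iter (1 : ℝ) (fun y => y ^ n) m x
  have term (k : ℕ) : fdiff k (fun y => y ^ n) x / (k.factorial : ℝ) *
      (descPochhammer ℝ k).eval (m : ℝ) = m.choose k * fdiff k (fun y => y ^ n) x := by
    rw [Nat.cast_choose_eq_descPochhammer_div]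
    ring
  simp only [nsmul_eq_mul, mul_one, ← fdiff_eq_fwdDiff_iter] at newton
  simp only [Set.mem_ofPred_eq, eval_pow, eval_add, eval_X, eval_C, eval_finsetSum, eval_mul, term]
  rw [add_comm, newton]
  trans ∑ k ∈ range (max m n + 1), (m.choose k : ℝ) * fdiff k (fun y => y ^ n) x
  · refine sum_subset (range_mono (by omega)) fun k _ hk => ?_
    rw [Nat.choose_eq_zero_of_lt (by simpa using hk), Nat.cast_zero, zero_mul]
  · refine (sum_subset (range_mono (by omega)) fun k _ hk => ?_).symm
    rw [fdiff_pow_eq_zero_of_lt (by simpa using hk), mul_zero]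

theorem sum_fdiff_mul_stirling1 (n i : ℕ) (x : ℝ) :
    ∑ k ∈ range (n + 1), fdiff k (fun y => y ^ n) x / (k.factorial : ℝ) * stirling1 k i =
      x ^ (n - i) * n.choose i := by
  simp_rw [stirling1_eq_coeff_descPochhammer, ← Polynomial.coeff_X_add_C_pow,
    X_add_C_pow_eq_sum_fdiff, Polynomial.finsetSum_coeff, Polynomial.coeff_C_mul]

theorem IsAppell.coeff_eq {A : ℕ → Polynomial ℝ} (hA : IsAppell A) (n m : ℕ) :
    (A n).coeff m = n.choose m * (A (n - m)).eval 0 := by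
  obtain ⟨-, ⟨c, hc⟩, hder⟩ := hA
  induction m generalizing n with
  | zero => simp [Polynomial.coeff_zero_eq_eval_zero]
  | succ m ih =>
    cases n with
    | zero => simp [hc]
    | succ n =>
      have h := congrArg (fun p => Polynomial.coeff p m) (hder n)
      simp only [Polynomial.coeff_derivative, Polynomial.coeff_smul, smul_eq_mul, ih] at h
      have hchoose : ((n : ℝ) + 1) * n.choose m = (n + 1).choose (m + 1) * ((m : ℝ) + 1) := by
        exact_mod_cast Nat.add_one_mul_choose_eq n m
      rw [← mul_assoc, hchoose] at h
      rw [Nat.add_sub_add_right]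
      refine mul_right_cancel₀ (Nat.cast_add_one_ne_zero m) (h.trans ?_)
      ring

theorem IsAppell.eval_eq {A : ℕ → Polynomial ℝ} (hA : IsAppell A) (n : ℕ) (x : ℝ) :
    (A n).eval x = ∑ i ∈ range (n + 1), x ^ (n - i) * n.choose i * (A i).eval 0 := by
  have hdeg : (A n).natDegree < n + 1 := by
    refine Nat.lt_succ_of_le (Polynomial.natDegree_le_iff_coeff_eq_zero.2 fun m hm => ?_)
    rw [hA.coeff_eq, Nat.choose_eq_zero_of_lt hm, Nat.cast_zero, zero_mul]
  rw [Polynomial.eval_eq_sum_range' hdeg, ← sum_range_reflect]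
  refine sum_congr rfl fun i hi => ?_
  have hi : i ≤ n := Nat.lt_succ_iff.1 (mem_range.1 hi)
  rw [hA.coeff_eq, Nat.add_sub_cancel, Nat.choose_symm hi, Nat.sub_sub_self hi]
  ring

theorem IsAppell.eval_eq_sum_fdiff {A : ℕ → Polynomial ℝ} (hA : IsAppell A) {a : ℕ → ℝ}
    (ha : ∀ n, a n = ∑ k ∈ range (n + 1), stirling1 n k * (A k).eval 0) (n : ℕ) (x : ℝ) :
    (A n).eval x = ∑ k ∈ range (n + 1),
      a k / (k.factorial : ℝ) * fdiff k (fun y => y ^ n) x := by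
  have ha' (k : ℕ) (hk : k ∈ range (n + 1)) :
      a k = ∑ i ∈ range (n + 1), stirling1 k i * (A i).eval 0 := by
    rw [ha]
    refine sum_subset (range_mono (by simpa using hk)) fun i _ hi => ?_
    rw [stirling1_eq_zero_of_lt (by simpa using hi), zero_mul]
  simp_rw [hA.eval_eq n x, ← sum_fdiff_mul_stirling1, sum_mul]
  rw [sum_comm]
  refine sum_congr rfl fun k hk => ?_
  rw [ha' k hk, sum_div, sum_mul]
  exact sum_congr rfl fun i _ => by ring

/-- The coefficients of a forward difference transformation of the monomials are determined by
its values at any point. -/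
theorem eq_of_sum_fdiff_eq {a b : ℕ → ℝ} (x : ℝ)
    (h : ∀ n : ℕ, ∑ k ∈ range (n + 1), b k / (k.factorial : ℝ) * fdiff k (fun y => y ^ n) x =
      ∑ k ∈ range (n + 1), a k / (k.factorial : ℝ) * fdiff k (fun y => y ^ n) x) : b = a := by
  funext n
  induction n using Nat.strong_induction_on with
  | _ n ih =>
    have hn := h n
    have lower : ∑ k ∈ range n, b k / (k.factorial : ℝ) * fdiff k (fun y => y ^ n) x =
        ∑ k ∈ range n, a k / (k.factorial : ℝ) * fdiff k (fun y => y ^ n) x :=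
      sum_congr rfl fun k hk => by rw [ih k (mem_range.1 hk)]
    have hfact : (n.factorial : ℝ) ≠ 0 := Nat.cast_ne_zero.2 n.factorial_ne_zero
    rwa [sum_range_succ, sum_range_succ, lower, add_right_inj, fdiff_pow_self,
      div_mul_cancel₀ _ hfact, div_mul_cancel₀ _ hfact] at hn

/-- every Appell sequence is a forward difference transformation of the
identity, with unique associated sequence `a_n = ∑_{k=0}^n s(n,k) A_k(0)`. -/
theorem appell_closed_form (A : ℕ → Polynomial ℝ) (hA : IsAppell A) (a : ℕ → ℝ)
    (ha : ∀ n, a n = ∑ k ∈ Finset.range (n + 1), stirling1 n k * (A k).eval 0) :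
    (∀ n : ℕ, ∀ x : ℝ,
        (A n).eval x = ∑ k ∈ Finset.range (n + 1),
          a k / (k.factorial : ℝ) * fdiff k (fun y => y ^ n) x) ∧
    (∀ b : ℕ → ℝ,
        (∀ n : ℕ, ∀ x : ℝ,
            (A n).eval x = ∑ k ∈ Finset.range (n + 1),
              b k / (k.factorial : ℝ) * fdiff k (fun y => y ^ n) x) → b = a) ∧
    (∀ n : ℕ, (A n).eval 0 = ∑ k ∈ Finset.range (n + 1), stirling2 n k * a k) := by
  have expansion := hA.eval_eq_sum_fdiff ha
  refine ⟨expansion, fun b hb => eq_of_sum_fdiff_eq 0 fun n => ?_, fun n => ?_⟩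
  · rw [← hb, expansion]
  · rw [expansion]
    refine sum_congr rfl fun k _ => ?_
    rw [stirling2_eq_fdiff_div]
    ring
end

section
/- Let a = (a_n)_{n≥0}, b = (b_n)_{n≥0}, c = (c_n)_{n≥0} be real sequences with a_0 ≠ 0, c_0 ≠ 0. Then for every n ≥ 0 and real x: (a) ((L_a I) × (L_c I))_n(x) = (L_{a×c} I)_n(x); (b) if (a×c)_0 = 1 and (a×c)_n = 0 for n ≥ 1, then ((L_a I) × (L_c I))_n(x) = x^n, i.e. the inverse of L_a I in the group of Appell sequences under binomial convolution is L_c I with c the binomial-convolution inverse of a; (c) (L_b (L_a I))_n(x) = (L_{a×b} I)_n(x). -/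
open Finset MeasureTheory

section ForwardDifference

open Polynomial

lemma eval_fdiffP (k : ℕ) (p : ℝ[X]) (x : ℝ) :
    (fdiffP k p).eval x = (fwdDiff 1)^[k] p.eval x := by
  rw [fwdDiff_iter_eq_sum_shift, fdiffP, eval_finsetSum]
  refine Finset.sum_congr rfl fun j _ => ?_
  simp [mul_comm]

lemma fdiffP_zero (p : ℝ[X]) : fdiffP 0 p = p := by
  simp [fdiffP]

lemma fdiffP_fdiffP (k j : ℕ) (p : ℝ[X]) : fdiffP k (fdiffP j p) = fdiffP (k + j) p := by
  refine Polynomial.funext fun x => ?_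
  rw [eval_fdiffP, eval_fdiffP, Function.iterate_add_apply,
    show (fdiffP j p).eval = (fwdDiff 1)^[j] p.eval from _root_.funext (eval_fdiffP j p)]

lemma fdiffP_sum_smul {ι : Type*} (k : ℕ) (s : Finset ι) (r : ι → ℝ) (p : ι → ℝ[X]) :
    fdiffP k (∑ i ∈ s, r i • p i) = ∑ i ∈ s, r i • fdiffP k (p i) := by
  simp only [fdiffP, Polynomial.sum_comp, smul_comp, Finset.smul_sum]
  rw [Finset.sum_comm]
  exact Finset.sum_congr rfl fun i _ => Finset.sum_congr rfl fun j _ => smul_comm _ _ _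

lemma fdiffP_X_pow_of_lt {k n : ℕ} (h : n < k) : fdiffP k ((X : ℝ[X]) ^ n) = 0 := by
  refine Polynomial.funext fun x => ?_
  rw [eval_fdiffP, fwdDiff_iter_eq_zero_of_degree_lt (by simpa using h)]
  simp

lemma LP_X_pow_of_le (u : ℕ → ℝ) {n N : ℕ} (h : n ≤ N) :
    LP u (fun n => (X : ℝ[X]) ^ n) n =
      ∑ k ∈ Finset.range (N + 1), (u k / (k.factorial : ℝ)) • fdiffP k ((X : ℝ[X]) ^ n) := by
  refine Finset.sum_subset (Finset.range_subset_range.2 (by omega)) fun k _ hk => ?_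
  rw [fdiffP_X_pow_of_lt (by simpa using hk), smul_zero]

/-- The Appell expansion of `Δ^k X^n` in terms of the constant terms of `Δ^k X^m`. -/
lemma fdiffP_X_pow (k n : ℕ) :
    fdiffP k ((X : ℝ[X]) ^ n) =
      ∑ m ∈ Finset.range (n + 1),
        ((n.choose m : ℝ) * (fdiffP k ((X : ℝ[X]) ^ m)).eval 0) • X ^ (n - m) := by
  refine Polynomial.funext fun x => ?_
  simp only [fdiffP, eval_finsetSum, eval_smul, eval_comp, eval_pow, eval_add, eval_X, eval_C,
    smul_eq_mul, zero_add, Finset.mul_sum, Finset.sum_mul]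
  rw [Finset.sum_comm]
  refine Finset.sum_congr rfl fun j _ => ?_
  rw [add_comm x, add_pow, Finset.mul_sum]
  exact Finset.sum_congr rfl fun m _ => by ring

lemma LP_X_pow_eq_sum (u : ℕ → ℝ) (n : ℕ) :
    LP u (fun n => (X : ℝ[X]) ^ n) n =
      ∑ m ∈ Finset.range (n + 1),
        ((n.choose m : ℝ) * (LP u (fun n => (X : ℝ[X]) ^ n) m).eval 0) • X ^ (n - m) := by
  have h : ∀ m ∈ Finset.range (n + 1),
      ((n.choose m : ℝ) * (LP u (fun n => (X : ℝ[X]) ^ n) m).eval 0) • (X : ℝ[X]) ^ (n - m) =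
        ∑ k ∈ Finset.range (n + 1), (u k / (k.factorial : ℝ)) •
          ((n.choose m : ℝ) * (fdiffP k ((X : ℝ[X]) ^ m)).eval 0) • (X : ℝ[X]) ^ (n - m) := by
    intro m hm
    rw [LP_X_pow_of_le u (Finset.mem_range_succ_iff.1 hm), eval_finsetSum, Finset.mul_sum,
      Finset.sum_smul]
    refine Finset.sum_congr rfl fun k _ => ?_
    rw [smul_smul, eval_smul, smul_eq_mul, mul_left_comm]
  rw [Finset.sum_congr rfl h, Finset.sum_comm]
  refine Finset.sum_congr rfl fun k _ => ?_
  rw [← Finset.smul_sum, ← fdiffP_X_pow]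

lemma aconv_LP_X_pow (a c : ℕ → ℝ) (n : ℕ) :
    aconv (LP a fun n => (X : ℝ[X]) ^ n) (LP c fun n => (X : ℝ[X]) ^ n) n =
      LP c (LP a fun n => (X : ℝ[X]) ^ n) n := by
  rw [LP, LP_X_pow_eq_sum a n, aconv]
  simp only [fdiffP_sum_smul, Finset.smul_sum]
  rw [Finset.sum_comm]
  refine Finset.sum_congr rfl fun m _ => ?_
  rw [LP_X_pow_of_le c (Nat.sub_le n m), Finset.smul_sum]
  exact Finset.sum_congr rfl fun k _ => smul_comm _ _ _

lemma LP_LP_X_pow (a b : ℕ → ℝ) (n : ℕ) :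
    LP b (LP a fun n => (X : ℝ[X]) ^ n) n = LP (bconv a b) (fun n => (X : ℝ[X]) ^ n) n := by
  let f : ℕ → ℕ → ℝ[X] := fun j k =>
    (a j / (j.factorial : ℝ) * (b k / (k.factorial : ℝ))) • fdiffP (j + k) (X ^ n)
  have hl : LP b (LP a fun n => (X : ℝ[X]) ^ n) n =
      ∑ j ∈ Finset.range (n + 1), ∑ k ∈ Finset.range (n + 1), f j k := by
    simp only [LP, fdiffP_sum_smul, Finset.smul_sum, fdiffP_fdiffP]
    rw [Finset.sum_comm]
    refine Finset.sum_congr rfl fun j _ => Finset.sum_congr rfl fun k _ => ?_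
    rw [smul_smul, mul_comm, add_comm k]
  have hr : LP (bconv a b) (fun n => (X : ℝ[X]) ^ n) n =
      ∑ m ∈ Finset.range (n + 1), ∑ j ∈ Finset.range (m + 1), f j (m - j) := by
    refine Finset.sum_congr rfl fun m _ => ?_
    rw [bconv, Finset.sum_div, Finset.sum_smul]
    refine Finset.sum_congr rfl fun j hj => ?_
    have hjm : j ≤ m := Finset.mem_range_succ_iff.1 hj
    simp only [f, Nat.add_sub_cancel' hjm, Nat.cast_choose ℝ hjm]
    congr 1
    have := Nat.factorial_ne_zero m
    field_simp
  rw [hl, hr, Finset.sum_range_diag_flip]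
  refine Finset.sum_congr rfl fun j _ => ?_
  symm
  refine Finset.sum_subset (Finset.range_subset_range.2 (Nat.sub_le _ _)) fun k _ hk => ?_
  have hlt : n < j + k := by
    rw [Finset.mem_range] at hk
    omega
  simp only [f, fdiffP_X_pow_of_lt hlt, smul_zero]

lemma LP_X_pow_of_eq_delta {u : ℕ → ℝ} (h0 : u 0 = 1) (h : ∀ m : ℕ, 1 ≤ m → u m = 0) (n : ℕ) :
    LP u (fun n => (X : ℝ[X]) ^ n) n = X ^ n := by
  rw [LP, Finset.sum_eq_single 0]
  · simp [h0, fdiffP_zero]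
  · intro k _ hk
    simp [h k (Nat.one_le_iff_ne_zero.2 hk)]
  · simp

end ForwardDifference

/-- behaviour of associated sequences under binomial convolution,
inversion, and forward difference transformations (stated for `L_a I`, `L_c I`, `L_b`). -/
theorem associated_sequence_rules (a b c : ℕ → ℝ) (ha0 : a 0 ≠ 0) (hc0 : c 0 ≠ 0)
    (n : ℕ) (x : ℝ) :
    (aconv (LP a fun n => (Polynomial.X : Polynomial ℝ) ^ n)
        (LP c fun n => (Polynomial.X : Polynomial ℝ) ^ n) n).eval x
      = (LP (bconv a c) (fun n => (Polynomial.X : Polynomial ℝ) ^ n) n).eval x ∧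
    ((bconv a c 0 = 1 ∧ ∀ m : ℕ, 1 ≤ m → bconv a c m = 0) →
      (aconv (LP a fun n => (Polynomial.X : Polynomial ℝ) ^ n)
          (LP c fun n => (Polynomial.X : Polynomial ℝ) ^ n) n).eval x = x ^ n) ∧
    (LP b (LP a fun n => (Polynomial.X : Polynomial ℝ) ^ n) n).eval x
      = (LP (bconv a b) (fun n => (Polynomial.X : Polynomial ℝ) ^ n) n).eval x := by
  refine ⟨?_, fun h => ?_, ?_⟩
  · rw [aconv_LP_X_pow, LP_LP_X_pow]
  · rw [aconv_LP_X_pow, LP_LP_X_pow, LP_X_pow_of_eq_delta h.1 h.2, Polynomial.eval_pow,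
      Polynomial.eval_X]
  · rw [LP_LP_X_pow]
end

section
/- Let (Ω, μ) be a probability space and Y : Ω → ℝ a random variable with E[e^{r|Y|}] < ∞ for some r > 0. Then for every n ≥ 0 and every real x, E[(x+Y)^n] = Σ_{k=0}^n E[C(Y,k)] · Δ^k I_n(x), where all the expectations are finite; in other words, the Appell sequence (E[(x+Y)^n])_{n≥0} has associated sequence y_n = E[Y(Y−1)⋯(Y−n+1)]. -/
open Finset MeasureTheory

theorem rchoose_eq_eval (y : ℝ) (k : ℕ) :
    rchoose y k =
      (Polynomial.C ((k.factorial : ℝ)⁻¹) * descPochhammer ℝ k).eval y := by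
  simp [rchoose, descPochhammer_eval_eq_prod_range, div_eq_inv_mul]

theorem rchoose_natCast (m k : ℕ) : rchoose m k = m.choose k := by
  rw [rchoose, ← descPochhammer_eval_eq_prod_range, ← Nat.cast_choose_eq_descPochhammer_div]

/-- Newton's expansion of a monomial at a natural number step. -/
theorem add_natCast_pow_eq_sum_rchoose_mul_fdiff (n m : ℕ) (x : ℝ) :
    (x + m) ^ n =
      ∑ k ∈ Finset.range (n + 1), rchoose m k * fdiff k (fun y => y ^ n) x := by
  have newton := shift_eq_sum_fwdDiff_iter (1 : ℝ) (fun y : ℝ => y ^ n) m x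
  simp only [nsmul_eq_mul, mul_one] at newton
  simp only [newton, rchoose_natCast, fdiff_eq_fwdDiff_iter]
  rcases le_total m n with h | h
  · refine Finset.sum_subset (Finset.range_mono (by lia)) fun k _ hk => ?_
    rw [Nat.choose_eq_zero_of_lt (by grind)]
    simp
  · refine (Finset.sum_subset (Finset.range_mono (by lia)) fun k _ hk => ?_).symm
    rw [fwdDiff_iter_pow_eq_zero_of_lt (by grind)]
    simp

/-- Newton's expansion of a monomial at an arbitrary real step. -/
theorem add_pow_eq_sum_rchoose_mul_fdiff (n : ℕ) (x y : ℝ) :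
    (x + y) ^ n =
      ∑ k ∈ Finset.range (n + 1), rchoose y k * fdiff k (fun z => z ^ n) x := by
  let p : Polynomial ℝ := (Polynomial.C x + Polynomial.X) ^ n
  let q : Polynomial ℝ := ∑ k ∈ Finset.range (n + 1),
    (Polynomial.C ((k.factorial : ℝ)⁻¹) * descPochhammer ℝ k) *
      Polynomial.C (fdiff k (fun z => z ^ n) x)
  have hp (z : ℝ) : p.eval z = (x + z) ^ n := by simp [p]
  have hq (z : ℝ) : q.eval z =
      ∑ k ∈ Finset.range (n + 1), rchoose z k * fdiff k (fun z => z ^ n) x := by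
    simp only [q, Polynomial.eval_finsetSum, rchoose_eq_eval, Polynomial.eval_mul,
      Polynomial.eval_C]
  have hpq : p = q := by
    refine Polynomial.eq_of_infinite_eval_eq p q
      ((Set.infinite_range_of_injective (Nat.cast_injective (R := ℝ))).mono ?_)
    rintro _ ⟨m, rfl⟩
    simpa only [Set.mem_ofPred_eq, hp, hq] using
      add_natCast_pow_eq_sum_rchoose_mul_fdiff n m x
  rw [← hp, ← hq, hpq]

theorem integrable_pow_of_integrable_exp_mul_abs {Ω : Type*} [MeasurableSpace Ω]
    {μ : Measure Ω} {Y : Ω → ℝ} (hY : Measurable Y) {r : ℝ} (hr : 0 < r)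
    (hint : Integrable (fun ω => Real.exp (r * |Y ω|)) μ) (n : ℕ) :
    Integrable (fun ω => Y ω ^ n) μ := by
  refine ProbabilityTheory.integrable_pow_of_integrable_exp_mul hr.ne'
    (hint.mono' (by fun_prop) ?_) (hint.mono' (by fun_prop) ?_) n
  all_goals
    refine Filter.Eventually.of_forall fun ω => ?_
    rw [Real.norm_eq_abs, Real.abs_exp, Real.exp_le_exp]
  · exact mul_le_mul_of_nonneg_left (le_abs_self _) hr.le
  · rw [neg_mul_comm]
    exact mul_le_mul_of_nonneg_left (neg_le_abs _) hr.le

theorem integrable_polynomial_eval {Ω : Type*} [MeasurableSpace Ω]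
    {μ : Measure Ω} {Y : Ω → ℝ} (hY : ∀ n : ℕ, Integrable (fun ω => Y ω ^ n) μ)
    (p : Polynomial ℝ) : Integrable (fun ω => p.eval (Y ω)) μ := by
  simp only [Polynomial.eval_eq_sum_range]
  exact integrable_finsetSum _ fun i _ => (hY i).const_mul _

/-- for a random variable `Y` with finite exponential moment,
`E[(x+Y)^n] = ∑_{k=0}^n E[C(Y,k)] Δ^k I_n(x)`, all expectations being finite. -/
theorem expectation_transform_closed_form {Ω : Type*} [MeasurableSpace Ω]
    (μ : Measure Ω) [IsProbabilityMeasure μ] (Y : Ω → ℝ) (hY : Measurable Y)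
    (r : ℝ) (hr : 0 < r) (hint : Integrable (fun ω => Real.exp (r * |Y ω|)) μ)
    (n : ℕ) (x : ℝ) :
    Integrable (fun ω => (x + Y ω) ^ n) μ ∧
    (∀ k : ℕ, k ≤ n → Integrable (fun ω => rchoose (Y ω) k) μ) ∧
    ∫ ω, (x + Y ω) ^ n ∂μ
      = ∑ k ∈ Finset.range (n + 1),
          (∫ ω, rchoose (Y ω) k ∂μ) * fdiff k (fun y => y ^ n) x := by
  have integrable_eval := integrable_polynomial_eval
    (integrable_pow_of_integrable_exp_mul_abs hY hr hint)
  have integrable_rchoose (k : ℕ) : Integrable (fun ω => rchoose (Y ω) k) μ := by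
    simpa only [rchoose_eq_eval] using
      integrable_eval (Polynomial.C ((k.factorial : ℝ)⁻¹) * descPochhammer ℝ k)
  refine ⟨?_, fun k _ => integrable_rchoose k, ?_⟩
  · refine (integrable_eval ((Polynomial.C x + Polynomial.X) ^ n)).congr
      (Filter.Eventually.of_forall fun ω => ?_)
    simp
  · simp only [add_pow_eq_sum_rchoose_mul_fdiff n x]
    rw [integral_finsetSum _ fun k _ => (integrable_rchoose k).mul_const _]
    simp only [integral_mul_const]
end

section
/- Fix t ∈ ℝ and define b_n(t) = Σ_{k=0}^n [C(t,k)·C(n−t,n−k)/C(k+n,n)] · s(k+n,k) for n ≥ 0. Then there exists ρ > 0 such that for every real x and every real z with 0 < |z| < ρ, the series Σ_{n≥0} (Σ_{k=0}^n (b_k(t)/k!) Δ^k I_n(x)) z^n/n! converges absolutely and equals (z/(e^z−1))^t · e^{xz}; that is, (b_n(t))_{n≥0} is the associated sequence of the generalized Bernoulli polynomials B_n(t;x) of order t, so B_n(t;x) = Σ_{k=0}^n (b_k(t)/k!) Δ^k I_n(x). -/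
open Finset MeasureTheory

section ForwardDifference

theorem fdiff_eq_iterate_fwdDiff (k : ℕ) (f : ℝ → ℝ) (x : ℝ) :
    fdiff k f x = (fwdDiff (1 : ℝ))^[k] f x := by
  rw [fwdDiff_iter_eq_sum_shift, fdiff]
  refine Finset.sum_congr rfl fun j _ => ?_
  simp only [nsmul_eq_mul, mul_one, zsmul_eq_mul]
  push_cast
  ring

theorem fdiff_zero (f : ℝ → ℝ) (x : ℝ) : fdiff 0 f x = f x := by
  simp [fdiff]

theorem fdiff_succ_pow (k n : ℕ) (x : ℝ) :
    fdiff (k + 1) (fun y => y ^ n) x =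
      ∑ m ∈ Finset.range n, (n.choose m : ℝ) * fdiff k (fun y => y ^ m) x := by
  have h : fwdDiff (1 : ℝ) (fun y : ℝ => y ^ n) =
      ∑ m ∈ Finset.range n, (n.choose m : ℝ) • fun y : ℝ => y ^ m := by
    ext y
    simp [fwdDiff, add_pow, Finset.sum_range_succ, mul_comm]
  simp only [fdiff_eq_iterate_fwdDiff, Function.iterate_succ_apply, h, fwdDiff_iter_finsetSum,
    fwdDiff_iter_const_smul, Finset.sum_apply, Pi.smul_apply, smul_eq_mul]

theorem fdiff_pow_eq_zero {k n : ℕ} (h : n < k) (x : ℝ) : fdiff k (fun y => y ^ n) x = 0 := by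
  induction k generalizing n with
  | zero => omega
  | succ k ih =>
    rw [fdiff_succ_pow]
    refine Finset.sum_eq_zero fun m hm => ?_
    rw [ih (by have := Finset.mem_range.1 hm; omega), mul_zero]

theorem abs_fdiff_pow_le (k n : ℕ) (x : ℝ) :
    |fdiff k (fun y => y ^ n) x| ≤ fdiff k (fun y => y ^ n) |x| := by
  induction k generalizing n with
  | zero => simp [fdiff_zero, abs_pow]
  | succ k ih =>
    rw [fdiff_succ_pow, fdiff_succ_pow]
    refine (Finset.abs_sum_le_sum_abs _ _).trans (Finset.sum_le_sum fun m _ => ?_)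
    rw [abs_mul, Nat.abs_cast]
    exact mul_le_mul_of_nonneg_left (ih m) (Nat.cast_nonneg _)

theorem hasSum_fdiff_pow (k : ℕ) (x z : ℝ) :
    HasSum (fun n : ℕ => fdiff k (fun y => y ^ n) x * z ^ n / (n.factorial : ℝ))
      ((Real.exp z - 1) ^ k * Real.exp (x * z)) := by
  have hexp (y : ℝ) : HasSum (fun n : ℕ => y ^ n / (n.factorial : ℝ)) (Real.exp y) := by
    rw [Real.exp_eq_exp_ℝ]
    exact NormedSpace.expSeries_div_hasSum_exp y
  have h := hasSum_sum (s := Finset.range (k + 1)) fun j _ =>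
    (hexp ((x + j) * z)).mul_left ((k.choose j : ℝ) * (-1 : ℝ) ^ (k - j))
  have hsum : ∑ j ∈ Finset.range (k + 1), (k.choose j : ℝ) * (-1 : ℝ) ^ (k - j) *
      Real.exp ((x + j) * z) = (Real.exp z - 1) ^ k * Real.exp (x * z) := by
    rw [sub_eq_add_neg, add_pow, Finset.sum_mul]
    refine Finset.sum_congr rfl fun j _ => ?_
    rw [add_mul, Real.exp_add, Real.exp_nat_mul]
    ring
  rw [hsum] at h
  have hterm (n : ℕ) : fdiff k (fun y => y ^ n) x * z ^ n / (n.factorial : ℝ) =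
      ∑ j ∈ Finset.range (k + 1), (k.choose j : ℝ) * (-1 : ℝ) ^ (k - j) *
        (((x + j) * z) ^ n / (n.factorial : ℝ)) := by
    simp only [fdiff, Finset.sum_mul, Finset.sum_div, mul_pow]
    exact Finset.sum_congr rfl fun j _ => by ring
  simpa only [hterm] using h

theorem hasSum_forwardDifference_transform {c : ℕ → ℝ} {z : ℝ}
    (hc : Summable fun k => |c k| * (Real.exp |z| - 1) ^ k) {s : ℝ}
    (hs : HasSum (fun k => c k * (Real.exp z - 1) ^ k) s) (x : ℝ) :
    HasSum (fun n : ℕ => (∑ k ∈ Finset.range (n + 1), c k * fdiff k (fun y => y ^ n) x) *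
      z ^ n / (n.factorial : ℝ)) (s * Real.exp (x * z)) := by
  let f : ℕ × ℕ → ℝ := fun p =>
    c p.1 * (fdiff p.1 (fun y => y ^ p.2) x * z ^ p.2 / (p.2.factorial : ℝ))
  let g : ℕ × ℕ → ℝ := fun p =>
    |c p.1| * (fdiff p.1 (fun y => y ^ p.2) |x| * |z| ^ p.2 / (p.2.factorial : ℝ))
  have hfg (p : ℕ × ℕ) : ‖f p‖ ≤ g p := by
    simp only [f, g, Real.norm_eq_abs, abs_mul, abs_div, abs_pow, Nat.abs_cast]
    gcongr
    exact abs_fdiff_pow_le _ _ _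
  have hg_sum (k : ℕ) : HasSum (fun n => g (k, n))
      (|c k| * ((Real.exp |z| - 1) ^ k * Real.exp (|x| * |z|))) :=
    (hasSum_fdiff_pow k |x| |z|).mul_left |c k|
  have hg : Summable g := by
    refine (summable_prod_of_nonneg fun p => (norm_nonneg _).trans (hfg p)).2
      ⟨fun k => (hg_sum k).summable, ?_⟩
    simp only [(hg_sum _).tsum_eq, ← mul_assoc]
    exact hc.mul_right _
  have hf : Summable f := hg.of_norm_bounded hfg
  have hk (k : ℕ) : HasSum (fun n => f (k, n))
      (c k * ((Real.exp z - 1) ^ k * Real.exp (x * z))) :=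
    (hasSum_fdiff_pow k x z).mul_left (c k)
  have htotal : ∑' p, f p = s * Real.exp (x * z) := by
    refine (hf.hasSum.prod_fiberwise hk).unique ?_
    simpa only [mul_assoc] using hs.mul_right (Real.exp (x * z))
  have hswap : HasSum (f ∘ Prod.swap) (s * Real.exp (x * z)) :=
    (Equiv.prodComm ℕ ℕ).hasSum_iff.2 (htotal ▸ hf.hasSum)
  refine hswap.prod_fiberwise fun n => ?_
  have hn := hasSum_sum_of_ne_finset_zero (f := fun k => f (k, n)) (s := Finset.range (n + 1))
    (L := .unconditional ℕ) fun k hk => by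
      have : n < k := by simpa using hk
      simp [f, fdiff_pow_eq_zero this]
  have heq : ∑ k ∈ Finset.range (n + 1), f (k, n) =
      (∑ k ∈ Finset.range (n + 1), c k * fdiff k (fun y => y ^ n) x) *
        z ^ n / (n.factorial : ℝ) := by
    simp only [f, Finset.sum_mul, Finset.sum_div]
    exact Finset.sum_congr rfl fun k _ => by ring
  exact heq ▸ hn

end ForwardDifference

section Interpolation

theorem eval_lagrange_basis_range (k m : ℕ) (t : ℝ) :
    (Lagrange.basis (Finset.range (k + m + 1)) (fun i : ℕ => (i : ℝ)) k).eval t =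
      rchoose t k * rchoose (((k + m : ℕ) : ℝ) - t) m := by
  let f : ℕ → ℝ := fun j => if j = k then 1 else ((k : ℝ) - j)⁻¹ * (t - j)
  have hbasis : (Lagrange.basis (Finset.range (k + m + 1)) (fun i : ℕ => (i : ℝ)) k).eval t =
      ∏ j ∈ Finset.range (k + 1 + m), f j := by
    rw [add_right_comm, ← Finset.prod_erase (Finset.range (k + 1 + m)) (a := k) (by simp [f]),
      Lagrange.basis, Polynomial.eval_prod]
    refine Finset.prod_congr rfl fun j hj => ?_
    simp [f, Finset.ne_of_mem_erase hj, Lagrange.basisDivisor]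
  have hlow : ∏ j ∈ Finset.range k, f j = rchoose t k := by
    have hfact : (k.factorial : ℝ) = ∏ j ∈ Finset.range k, ((k : ℝ) - j) := by
      rw [← Nat.descFactorial_self, Nat.descFactorial_eq_prod_range, Nat.cast_prod]
      exact Finset.prod_congr rfl fun j hj => Nat.cast_sub (Finset.mem_range.1 hj).le
    rw [rchoose, hfact, ← Finset.prod_div_distrib]
    refine Finset.prod_congr rfl fun j hj => ?_
    simp only [f, if_neg (Finset.mem_range.1 hj).ne]
    ring
  have hhigh : ∏ j ∈ Finset.range m, f (k + 1 + j) = rchoose (((k + m : ℕ) : ℝ) - t) m := by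
    rw [rchoose, ← Finset.prod_range_reflect (fun i : ℕ => ((k + m : ℕ) : ℝ) - t - i),
      ← Finset.prod_range_add_one_eq_factorial, Nat.cast_prod, ← Finset.prod_div_distrib]
    refine Finset.prod_congr rfl fun j hj => ?_
    have hj' : j + 1 ≤ m := Finset.mem_range.1 hj
    have hne : (j : ℝ) + 1 ≠ 0 := by positivity
    have hsub : ((m - 1 - j : ℕ) : ℝ) = m - 1 - j := by
      rw [Nat.sub_sub, Nat.cast_sub (by omega)]
      push_cast
      ring
    simp only [f, if_neg (show k + 1 + j ≠ k by omega), hsub]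
    push_cast
    rw [show (k : ℝ) - (k + 1 + j) = -(j + 1) by ring]
    field_simp
    ring
  rw [hbasis, Finset.prod_range_add, Finset.prod_range_succ, hlow, hhigh]
  simp [f]

theorem eval_eq_sum_rchoose {n : ℕ} {p : Polynomial ℝ} (hp : p.natDegree ≤ n) (t : ℝ) :
    p.eval t = ∑ k ∈ Finset.range (n + 1),
      rchoose t k * rchoose ((n : ℝ) - t) (n - k) * p.eval (k : ℝ) := by
  have hdeg : p.degree < (Finset.range (n + 1)).card := by
    rw [Finset.card_range]
    exact Polynomial.degree_le_natDegree.trans_lt (by exact_mod_cast Nat.lt_succ_of_le hp)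
  conv_lhs => rw [Lagrange.eq_interpolate (v := fun i : ℕ => (i : ℝ))
    Nat.cast_injective.injOn hdeg]
  rw [Lagrange.interpolate_apply, Polynomial.eval_finsetSum]
  refine Finset.sum_congr rfl fun k hk => ?_
  obtain ⟨m, rfl⟩ := Nat.exists_eq_add_of_le (Nat.lt_succ_iff.1 (Finset.mem_range.1 hk))
  rw [Polynomial.eval_mul, Polynomial.eval_C, eval_lagrange_basis_range, Nat.add_sub_cancel_left]
  ring

end Interpolation

section Analytic

open Filter Topology Polynomial

theorem eval_zero_aeval_derivative_X_pow (P : ℝ[X]) (k : ℕ) :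
    (aeval (derivative : ℝ[X] →ₗ[ℝ] ℝ[X]) P (X ^ k)).eval 0 = k.factorial * P.coeff k := by
  induction P using Polynomial.induction_on' with
  | add p q hp hq => simp [hp, hq, mul_add]
  | monomial j a =>
    rw [aeval_monomial]
    simp only [Module.End.mul_apply, Module.algebraMap_end_apply, Module.End.pow_apply,
      eval_smul, ← coeff_zero_eq_eval_zero, coeff_iterate_derivative, zero_add,
      Nat.descFactorial_self, coeff_X_pow, coeff_monomial, smul_eq_mul, nsmul_eq_mul]
    split_ifs <;> simp_all [mul_comm]

theorem iteratedDeriv_eval_log_one_add (f : ℝ[X]) (m : ℕ) :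
    iteratedDeriv m (fun w : ℝ => f.eval (Real.log (1 + w))) =ᶠ[𝓝 0] fun w =>
      ((1 + w) ^ m)⁻¹ * (aeval (derivative : ℝ[X] →ₗ[ℝ] ℝ[X])
        (∏ i ∈ Finset.range m, (X - C (i : ℝ))) f).eval (Real.log (1 + w)) := by
  induction m with
  | zero => simp
  | succ m ih =>
    rw [iteratedDeriv_succ]
    refine ih.deriv.trans ?_
    filter_upwards [lt_mem_nhds (show (-1 : ℝ) < 0 by norm_num)] with w hw
    have hw' : 1 + w ≠ 0 := by linarith
    rw [Finset.prod_range_succ_comm, map_mul]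
    set q := aeval (derivative : ℝ[X] →ₗ[ℝ] ℝ[X])
        (∏ i ∈ Finset.range m, (X - C (i : ℝ))) f with hq
    have h1 : HasDerivAt (fun w : ℝ => 1 + w) 1 w := (hasDerivAt_id w).const_add 1
    have h2 := ((h1.pow m).inv (pow_ne_zero m hw')).mul
      ((q.hasDerivAt (Real.log (1 + w))).comp w (h1.log hw'))
    refine h2.deriv.trans ?_
    simp only [Module.End.mul_apply, ← hq, map_sub, aeval_X, aeval_C, LinearMap.sub_apply,
      Module.algebraMap_end_apply, eval_sub, eval_smul, smul_eq_mul]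
    rcases m with _ | m
    · simp
      field_simp
    · simp
      field_simp
      ring

theorem iteratedDeriv_log_one_add_pow_zero (m k : ℕ) :
    iteratedDeriv m (fun w : ℝ => Real.log (1 + w) ^ k) 0 = k.factorial * stirling1 m k := by
  have h := (iteratedDeriv_eval_log_one_add (X ^ k) m).eq_of_nhds
  simpa [eval_zero_aeval_derivative_X_pow, stirling1] using h

theorem iteratedDeriv_zero_of_pow_mul {n k : ℕ} {f : ℝ → ℝ} (hf : ContDiffAt ℝ (k + n : ℕ) f 0) :
    iteratedDeriv (k + n) (fun w => w ^ k * f w) 0 =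
      (k + n).choose n * k.factorial * iteratedDeriv n f 0 := by
  rw [iteratedDeriv_fun_mul (by fun_prop) hf, Finset.sum_eq_single k]
  · rw [iteratedDeriv_fun_pow_zero, if_pos rfl, Nat.choose_symm_add, Nat.add_sub_cancel_left]
  · intro i _ hi
    rw [iteratedDeriv_fun_pow_zero, if_neg hi, Nat.cast_zero, mul_zero, zero_mul]
  · simp

theorem iteratedDeriv_exp_mul_eventuallyEq {L : ℝ → ℝ} {x₀ : ℝ} (hL : AnalyticAt ℝ L x₀) (n : ℕ) :
    ∃ a : ℕ → ℝ → ℝ, (∀ j, AnalyticAt ℝ (a j) x₀) ∧ (∀ j, n < j → a j = 0) ∧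
      ∀ t : ℝ, iteratedDeriv n (fun w => Real.exp (t * L w)) =ᶠ[𝓝 x₀]
        fun w => (∑ j ∈ Finset.range (n + 1), t ^ j * a j w) * Real.exp (t * L w) := by
  induction n with
  | zero =>
    refine ⟨fun j => if j = 0 then 1 else 0, fun j => ?_, fun j hj => ?_, fun t => ?_⟩
    · dsimp only
      split_ifs
      exacts [analyticAt_const, analyticAt_const]
    · simp [hj.ne']
    · simp
  | succ n ih =>
    obtain ⟨a, ha, ha0, h⟩ := ih
    let a' : ℕ → ℝ → ℝ
      | 0 => deriv (a 0)
      | j + 1 => fun w => deriv (a (j + 1)) w + deriv L w * a j w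
    refine ⟨a', fun j => ?_, fun j hj => ?_, fun t => ?_⟩
    · cases j with
      | zero => exact (ha 0).deriv
      | succ j => exact (ha (j + 1)).deriv.add (hL.deriv.mul (ha j))
    · cases j with
      | zero => omega
      | succ j =>
        ext w
        simp [a', ha0 (j + 1) (by omega), ha0 j (by omega)]
    · rw [iteratedDeriv_succ]
      refine (h t).deriv.trans ?_
      have hev : ∀ᶠ w in 𝓝 x₀, ∀ j ∈ Finset.range (n + 1), AnalyticAt ℝ (a j) w :=
        (Finset.eventually_all _).2 fun j _ => (ha j).eventually_analyticAt
      filter_upwards [hev, hL.eventually_analyticAt] with w hw hLw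
      have h1 : HasDerivAt (fun w => ∑ j ∈ Finset.range (n + 1), t ^ j * a j w)
          (∑ j ∈ Finset.range (n + 1), t ^ j * deriv (a j) w) w :=
        HasDerivAt.fun_sum fun j hj =>
          (hw j hj).differentiableAt.hasDerivAt.const_mul (t ^ j)
      have h2 := h1.mul ((hLw.differentiableAt.hasDerivAt.const_mul t).exp)
      refine h2.deriv.trans ?_
      have hsplit : ∑ j ∈ Finset.range (n + 1 + 1), t ^ j * a' j w =
          ∑ j ∈ Finset.range (n + 1), t ^ j * deriv (a j) w +
            t * deriv L w * ∑ j ∈ Finset.range (n + 1), t ^ j * a j w := by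
        have htop : ∑ j ∈ Finset.range (n + 1), t ^ j * deriv (a j) w =
            ∑ j ∈ Finset.range (n + 1 + 1), t ^ j * deriv (a j) w := by
          rw [Finset.sum_range_succ _ (n + 1), ha0 (n + 1) (by omega)]
          simp
        rw [htop, Finset.sum_range_succ', Finset.sum_range_succ' _ (n + 1), Finset.mul_sum,
          add_right_comm, ← Finset.sum_add_distrib]
        congr 1
        refine Finset.sum_congr rfl fun j _ => ?_
        simp only [a']
        ring
      rw [hsplit]
      ring

theorem exists_polynomial_iteratedDeriv_exp_mul {L : ℝ → ℝ} {x₀ : ℝ} (hL : AnalyticAt ℝ L x₀)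
    (hL0 : L x₀ = 0) (n : ℕ) :
    ∃ p : ℝ[X], p.natDegree ≤ n ∧
      ∀ t : ℝ, iteratedDeriv n (fun w => Real.exp (t * L w)) x₀ = p.eval t := by
  obtain ⟨a, -, -, h⟩ := iteratedDeriv_exp_mul_eventuallyEq hL n
  refine ⟨∑ j ∈ Finset.range (n + 1), C (a j x₀) * X ^ j, ?_, fun t => ?_⟩
  · refine natDegree_sum_le_of_forall_le _ _ fun j hj => ?_
    exact (natDegree_C_mul_X_pow_le _ _).trans (Nat.lt_succ_iff.1 (Finset.mem_range.1 hj))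
  · rw [(h t).eq_of_nhds]
    simp only [hL0, mul_zero, Real.exp_zero, mul_one, eval_finsetSum, eval_mul, eval_C, eval_pow,
      eval_X]
    exact Finset.sum_congr rfl fun j _ => mul_comm _ _

/-- The function `log (1 + w) / w`, extended by continuity at `0`. -/
noncomputable def logQuotient : ℝ → ℝ := dslope (fun w => Real.log (1 + w)) 0

theorem mul_logQuotient (w : ℝ) : w * logQuotient w = Real.log (1 + w) := by
  simpa [logQuotient] using sub_smul_dslope (fun w => Real.log (1 + w)) 0 w

theorem logQuotient_zero : logQuotient 0 = 1 := by
  have h : HasDerivAt (fun w : ℝ => Real.log (1 + w)) (1 / (1 + 0)) 0 :=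
    ((hasDerivAt_id (0 : ℝ)).const_add 1).log (by simp)
  simpa [logQuotient, dslope_same] using h.deriv

theorem analyticAt_logQuotient : AnalyticAt ℝ logQuotient 0 := by
  have h : AnalyticAt ℝ (fun w : ℝ => Real.log (1 + w)) 0 :=
    (analyticAt_const.add analyticAt_id).log (by simp)
  exact h.hasFPowerSeriesAt.has_fpower_series_dslope_fslope.analyticAt

theorem analyticAt_log_logQuotient : AnalyticAt ℝ (fun w => Real.log (logQuotient w)) 0 :=
  analyticAt_logQuotient.log (by simp [logQuotient_zero])

theorem iteratedDeriv_logQuotient_pow (n k : ℕ) :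
    iteratedDeriv n (fun w => logQuotient w ^ k) 0 =
      stirling1 (k + n) k / (((k + n).choose n : ℕ) : ℝ) := by
  have h := iteratedDeriv_zero_of_pow_mul (n := n) (k := k)
    (analyticAt_logQuotient.pow k).contDiffAt
  simp only [Pi.pow_apply, ← mul_pow, mul_logQuotient, iteratedDeriv_log_one_add_pow_zero] at h
  have hk : (k.factorial : ℝ) ≠ 0 := by positivity
  have hc : (((k + n).choose n : ℕ) : ℝ) ≠ 0 :=
    Nat.cast_ne_zero.2 (Nat.choose_pos (Nat.le_add_left n k)).ne'
  rw [eq_div_iff hc]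
  refine mul_left_cancel₀ hk ?_
  rw [h]
  simp only [Pi.pow_def]
  ring

theorem iteratedDeriv_exp_mul_log_logQuotient (n : ℕ) (t : ℝ) :
    iteratedDeriv n (fun w => Real.exp (t * Real.log (logQuotient w))) 0 =
      ∑ k ∈ Finset.range (n + 1),
        rchoose t k * rchoose ((n : ℝ) - t) (n - k) / (((k + n).choose n : ℕ) : ℝ) *
          stirling1 (k + n) k := by
  obtain ⟨p, hp, h⟩ := exists_polynomial_iteratedDeriv_exp_mul analyticAt_log_logQuotient
    (by simp [logQuotient_zero]) n
  rw [h, eval_eq_sum_rchoose hp]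
  refine Finset.sum_congr rfl fun k _ => ?_
  have hpow : (fun w => Real.exp ((k : ℝ) * Real.log (logQuotient w))) =ᶠ[𝓝 0]
      fun w => logQuotient w ^ k := by
    have hpos : ∀ᶠ w in 𝓝 0, 0 < logQuotient w :=
      analyticAt_logQuotient.continuousAt.eventually_const_lt (by simp [logQuotient_zero])
    filter_upwards [hpos] with w hw
    rw [Real.exp_nat_mul, Real.exp_log hw]
  rw [← h, hpow.iteratedDeriv_eq, iteratedDeriv_logQuotient_pow]
  ring

theorem AnalyticAt.exists_hasSum_iteratedDeriv {f : ℝ → ℝ} (hf : AnalyticAt ℝ f 0) :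
    ∃ r : ℝ, 0 < r ∧ ∀ w : ℝ, |w| < r →
      Summable (fun n : ℕ => |iteratedDeriv n f 0 / n.factorial| * |w| ^ n) ∧
      HasSum (fun n : ℕ => iteratedDeriv n f 0 / n.factorial * w ^ n) (f w) := by
  obtain ⟨R, hR⟩ := hf.hasFPowerSeriesAt
  obtain ⟨r, hr0, hrR⟩ := ENNReal.lt_iff_exists_nnreal_btwn.1 hR.r_pos
  refine ⟨r, by exact_mod_cast hr0, fun w hw => ?_⟩
  have hmem : w ∈ Metric.eball (0 : ℝ) R := by
    refine Metric.eball_subset_eball hrR.le ?_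
    rw [Metric.eball_coe]
    simpa using hw
  constructor
  · have h := FormalMultilinearSeries.summable_norm_apply _ (Metric.eball_subset_eball hR.r_le hmem)
    simpa [FormalMultilinearSeries.ofScalars_apply_eq, abs_mul, abs_div, mul_comm] using h
  · have h := hR.hasSum hmem
    simpa [FormalMultilinearSeries.ofScalars_apply_eq, mul_comm] using h

theorem exp_mul_log_logQuotient_exp_sub_one {z : ℝ} (hz : z ≠ 0) (t : ℝ) :
    Real.exp (t * Real.log (logQuotient (Real.exp z - 1))) = (z / (Real.exp z - 1)) ^ t := by
  have hne : Real.exp z - 1 ≠ 0 := by simpa [sub_eq_zero] using hz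
  have hq : logQuotient (Real.exp z - 1) = z / (Real.exp z - 1) := by
    rw [eq_div_iff hne, mul_comm, mul_logQuotient]
    simp
  have hpos : 0 < z / (Real.exp z - 1) := by
    rcases hz.lt_or_gt with h | h
    · exact div_pos_of_neg_of_neg h (by simpa using h)
    · exact div_pos h (by simpa using h)
  rw [hq, Real.rpow_def_of_pos hpos, mul_comm]

theorem abs_exp_sub_one_le_exp_abs_sub_one (z : ℝ) : |Real.exp z - 1| ≤ Real.exp |z| - 1 := by
  rcases le_total 0 z with h | h
  · rw [abs_of_nonneg h, abs_of_nonneg (by simpa using h)]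
  · rw [abs_of_nonpos h, abs_of_nonpos (by simpa using h)]
    linarith [Real.add_one_le_exp z, Real.add_one_le_exp (-z)]

end Analytic

/-- the generalized Bernoulli polynomials of real order `t` have associated
sequence `b_n(t) = ∑_{k=0}^n [C(t,k)C(n-t,n-k)/C(k+n,n)] s(k+n,k)`, i.e. the generating
function of `∑_{k=0}^n (b_k(t)/k!) Δ^k I_n(x)` is `(z/(e^z-1))^t e^{xz}`. -/
theorem generalizedBernoulli_closed_form (t : ℝ) (b : ℕ → ℝ)
    (hb : ∀ n, b n = ∑ k ∈ Finset.range (n + 1),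
        rchoose t k * rchoose ((n : ℝ) - t) (n - k) / (((k + n).choose n : ℕ) : ℝ) *
          stirling1 (k + n) k) :
    ∃ ρ : ℝ, 0 < ρ ∧ ∀ x z : ℝ, 0 < |z| → |z| < ρ →
      Summable (fun n => |(∑ k ∈ Finset.range (n + 1),
          b k / (k.factorial : ℝ) * fdiff k (fun y => y ^ n) x) * z ^ n / (n.factorial : ℝ)|) ∧
      ∑' n : ℕ, (∑ k ∈ Finset.range (n + 1),
          b k / (k.factorial : ℝ) * fdiff k (fun y => y ^ n) x) * z ^ n / (n.factorial : ℝ)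
        = (z / (Real.exp z - 1)) ^ t * Real.exp (x * z) := by
  have hf : AnalyticAt ℝ (fun w => Real.exp (t * Real.log (logQuotient w))) 0 :=
    (analyticAt_const.mul analyticAt_log_logQuotient).rexp
  obtain ⟨r, hr, h⟩ := hf.exists_hasSum_iteratedDeriv
  simp only [iteratedDeriv_exp_mul_log_logQuotient, ← hb] at h
  refine ⟨Real.log (1 + r), Real.log_pos (by linarith), fun x z hz hzr => ?_⟩
  have hlt : Real.exp |z| - 1 < r := by
    have := (Real.lt_log_iff_exp_lt (by linarith)).1 hzr
    linarith
  have hnonneg : 0 ≤ Real.exp |z| - 1 := by simp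
  have hsummable := (h (Real.exp |z| - 1) (by rwa [abs_of_nonneg hnonneg])).1
  rw [abs_of_nonneg hnonneg] at hsummable
  have hsum := (h (Real.exp z - 1) ((abs_exp_sub_one_le_exp_abs_sub_one z).trans_lt hlt)).2
  rw [exp_mul_log_logQuotient_exp_sub_one (abs_pos.1 hz)] at hsum
  have hmain := hasSum_forwardDifference_transform hsummable hsum x
  exact ⟨hmain.summable.abs, hmain.tsum_eq⟩
end

section
/- For every m ∈ ℕ with m ≥ 1 and every n ≥ 0, Σ_{k=0}^n [C(m,k)·C(n−m,n−k)/C(k+n,n)] · s(k+n,k) = s(m+n,m)/C(m+n,n); that is, for integer order t = m the coefficients b_n(t) of the generalized Bernoulli polynomials reduce to b_n(m) = s(m+n,m)/C(m+n,n). -/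
open Finset MeasureTheory

open Polynomial in
/-- A first-order difference equation with polynomial right-hand side has a polynomial solution
of no larger degree; the operator is triangular on the rising factorials. -/
theorem exists_natDegree_le_of_difference_equation (a : ℝ) (ha : 0 < a) (d : ℕ) :
    ∀ q : ℝ[X], q.natDegree ≤ d → ∃ p : ℝ[X], p.natDegree ≤ d ∧
      ∀ x : ℝ, (a + x) * p.eval x - x * p.eval (x - 1) = q.eval x := by
  induction d with
  | zero =>
    intro q hq
    obtain ⟨c, rfl⟩ : ∃ c, C c = q := ⟨_, (eq_C_of_natDegree_le_zero hq).symm⟩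
    refine ⟨C (c / a), by simp, fun x => ?_⟩
    simp only [eval_C]
    field_simp
    ring
  | succ d ih =>
    intro q hq
    have hpos : a + d + 1 ≠ 0 := by positivity
    set c : ℝ := q.coeff (d + 1) / (a + d + 1) with hc
    set R : ℕ → ℝ[X] := ascPochhammer ℝ with hR
    have hdeg (i : ℕ) : (R i).natDegree = i := ascPochhammer_natDegree ℝ i
    have hlead : (R (d + 1)).coeff (d + 1) = 1 := by
      have h := monic_ascPochhammer ℝ (d + 1)
      rwa [Monic, leadingCoeff, ascPochhammer_natDegree] at h
    have hzero : (R d).coeff (d + 1) = 0 := coeff_eq_zero_of_natDegree_lt (by simp [hdeg])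
    obtain ⟨p, hp, hpe⟩ := ih
      (q - (C (c * (a + d + 1)) * R (d + 1) - C (c * (d * (d + 1))) * R d)) (by
        rw [natDegree_le_iff_coeff_eq_zero]
        intro N hN
        rcases (show d + 1 ≤ N from hN).eq_or_lt with rfl | h
        · simp only [coeff_sub, coeff_C_mul, hlead, hzero, hc]
          field_simp
          ring
        · simp only [coeff_sub, coeff_C_mul]
          rw [coeff_eq_zero_of_natDegree_lt (hq.trans_lt h),
            coeff_eq_zero_of_natDegree_lt (p := R (d + 1)) (by rw [hdeg]; exact h),
            coeff_eq_zero_of_natDegree_lt (p := R d) (by rw [hdeg]; omega)]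
          simp)
    refine ⟨p + C c * R (d + 1), ?_, fun x => ?_⟩
    · refine natDegree_add_le_of_degree_le (by omega) ?_
      exact (natDegree_C_mul_le _ _).trans (hdeg _).le
    · have h1 : (R (d + 1)).eval x = (R d).eval x * (x + d) := by
        simp [hR, ascPochhammer_succ_right]
      have h2 : (R (d + 1)).eval (x - 1) = (x - 1) * (R d).eval x := by
        simp [hR, ascPochhammer_succ_left]
      have h3 := hpe x
      simp only [eval_sub, eval_mul, eval_C, eval_add] at h3 ⊢
      rw [h2]
      rw [h1] at h3 ⊢
      linear_combination h3

theorem stirling1_succ_succ (n k : ℕ) :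
    stirling1 (n + 1) (k + 1) = stirling1 n k - n * stirling1 n (k + 1) := by
  simp only [stirling1]
  rw [Finset.prod_range_succ, mul_sub, Polynomial.coeff_sub, Polynomial.coeff_mul_X,
    Polynomial.coeff_mul_C, mul_comm (n : ℝ)]

theorem stirling1_succ_zero (n : ℕ) : stirling1 (n + 1) 0 = 0 := by
  simp [stirling1, Finset.prod_range_succ', Polynomial.mul_coeff_zero]

theorem stirling1_self (n : ℕ) : stirling1 n n = 1 := by
  have hm : (∏ i ∈ Finset.range n, (Polynomial.X - Polynomial.C (i : ℝ))).Monic :=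
    Polynomial.monic_prod_of_monic _ _ fun i _ => Polynomial.monic_X_sub_C _
  have hd : (∏ i ∈ Finset.range n, (Polynomial.X - Polynomial.C (i : ℝ))).natDegree = n := by
    rw [Polynomial.natDegree_prod_of_monic _ _ fun i _ => Polynomial.monic_X_sub_C _]
    simp only [Polynomial.natDegree_X_sub_C, Finset.sum_const, Finset.card_range, smul_eq_mul,
      mul_one]
  rw [Polynomial.Monic, Polynomial.leadingCoeff, hd] at hm
  exact hm

theorem stirling1_div_choose_recurrence (n k : ℕ) :
    ((n : ℝ) + k + 2) * (stirling1 (k + 1 + (n + 1)) (k + 1) / ((k + 1 + (n + 1)).choose (n + 1) : ℕ))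
      - (k + 1) * (stirling1 (k + (n + 1)) k / ((k + (n + 1)).choose (n + 1) : ℕ))
      = -((n + 1) * (n + k + 1)) *
        (stirling1 (k + 1 + n) (k + 1) / ((k + 1 + n).choose n : ℕ)) := by
  have hs := stirling1_succ_succ (k + n + 1) k
  have hD : (0 : ℝ) < ((k + n + 1).choose (n + 1) : ℕ) := by
    exact_mod_cast Nat.choose_pos (by omega)
  have h1 : (((k + n + 2).choose (n + 1) : ℕ) : ℝ) * (k + 1)
      = (k + n + 2) * ((k + n + 1).choose (n + 1) : ℕ) := by
    have h := Nat.choose_mul_succ_eq (k + n + 1) (n + 1)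
    rw [show k + n + 1 + 1 - (n + 1) = k + 1 by omega] at h
    have h' := congrArg (Nat.cast (R := ℝ)) h
    push_cast at h'
    linear_combination -h'
  have h2 : (((k + n + 1).choose n : ℕ) : ℝ) * (k + 1)
      = (n + 1) * ((k + n + 1).choose (n + 1) : ℕ) := by
    have h := Nat.choose_succ_right_eq (k + n + 1) n
    rw [show k + n + 1 - n = k + 1 by omega] at h
    have h' := congrArg (Nat.cast (R := ℝ)) h
    push_cast at h'
    linear_combination -h'
  have hk : (k : ℝ) + 1 ≠ 0 := by positivity
  have hn : (n : ℝ) + 1 ≠ 0 := by positivity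
  have hkn : (k : ℝ) + n + 2 ≠ 0 := by positivity
  rw [← eq_div_iff hk] at h1 h2
  rw [show k + 1 + (n + 1) = k + n + 2 by ring, show k + (n + 1) = k + n + 1 by ring,
    show k + 1 + n = k + n + 1 by ring, h1, h2, hs]
  have hD' := hD.ne'
  push_cast
  generalize (((k + n + 1).choose (n + 1) : ℕ) : ℝ) = D at *
  field_simp
  ring

/-- For fixed `n`, the quotient `s(k+n,k)/C(k+n,n)` is a polynomial in `k` of degree at most
`n`. -/
theorem exists_polynomial_stirling1_div_choose (n : ℕ) :
    ∃ p : Polynomial ℝ, p.natDegree ≤ n ∧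
      ∀ k : ℕ, p.eval (k : ℝ) = stirling1 (k + n) k / (((k + n).choose n : ℕ) : ℝ) := by
  induction n with
  | zero => exact ⟨1, by simp, fun k => by simp [stirling1_self]⟩
  | succ n ih =>
    obtain ⟨q, hq, hqe⟩ := ih
    obtain ⟨p, hp, hpe⟩ := exists_natDegree_le_of_difference_equation ((n : ℝ) + 1)
      (by positivity) (n + 1)
      (Polynomial.C (-((n : ℝ) + 1)) * ((Polynomial.X + Polynomial.C (n : ℝ)) * q)) (by
        refine (Polynomial.natDegree_C_mul_le _ _).trans (Polynomial.natDegree_mul_le.trans ?_)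
        rw [Polynomial.natDegree_X_add_C]
        omega)
    refine ⟨p, hp, fun k => ?_⟩
    simp only [Polynomial.eval_mul, Polynomial.eval_add, Polynomial.eval_X,
      Polynomial.eval_C] at hpe
    induction k with
    | zero =>
      have h0 : (n : ℝ) * q.eval 0 = 0 := by
        have h := hqe 0
        cases n with
        | zero => simp
        | succ j =>
          rw [zero_add, stirling1_succ_zero, zero_div, Nat.cast_zero] at h
          rw [h, mul_zero]
      have hn : (n : ℝ) + 1 ≠ 0 := by positivity
      rw [zero_add, stirling1_succ_zero, zero_div, Nat.cast_zero]
      apply mul_left_cancel₀ hn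
      linear_combination hpe 0 - (n + 1) * h0
    | succ k ihk =>
      have hr := stirling1_div_choose_recurrence n k
      rw [← hqe (k + 1), ← ihk] at hr
      have hx := hpe ((k : ℝ) + 1)
      rw [add_sub_cancel_right] at hx
      have hne : (n : ℝ) + k + 2 ≠ 0 := by positivity
      apply mul_left_cancel₀ hne
      push_cast at hr ⊢
      linear_combination hx - hr

theorem rchoose_natCast_self (k : ℕ) : rchoose (k : ℝ) k = 1 := by
  have h : ∏ i ∈ Finset.range k, ((k : ℝ) - i) = k.factorial := by
    induction k with
    | zero => simp
    | succ k ih =>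
      rw [Finset.prod_range_succ', Nat.factorial_succ, Nat.cast_mul, ← ih, mul_comm]
      simp
  rw [rchoose, h, div_self (by positivity)]

theorem rchoose_natCast_of_lt {i k : ℕ} (h : i < k) : rchoose (i : ℝ) k = 0 := by
  rw [rchoose, Finset.prod_eq_zero (Finset.mem_range.mpr h) (sub_self _), zero_div]

open Polynomial in
/-- `y ↦ C(y,k)` is a polynomial function of degree at most `k`. -/
theorem exists_polynomial_rchoose (k : ℕ) :
    ∃ p : ℝ[X], p.natDegree ≤ k ∧ ∀ y : ℝ, p.eval y = rchoose y k := by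
  refine ⟨C ((k.factorial : ℝ)⁻¹) * ∏ i ∈ Finset.range k, (X - C (i : ℝ)), ?_, fun y => ?_⟩
  · refine (natDegree_C_mul_le _ _).trans ((natDegree_prod_le _ _).trans ?_)
    simp only [natDegree_X_sub_C, Finset.sum_const, Finset.card_range, smul_eq_mul, mul_one,
      le_refl]
  · simp [rchoose, eval_prod, div_eq_inv_mul]

open Polynomial in
/-- Lagrange interpolation at `0, 1, …, n`, written with generalized binomial coefficients. -/
theorem sum_rchoose_mul_rchoose_mul_eval (n : ℕ) (p : ℝ[X]) (hp : p.natDegree ≤ n) (y : ℝ) :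
    ∑ k ∈ Finset.range (n + 1), rchoose y k * rchoose ((n : ℝ) - y) (n - k) * p.eval (k : ℝ)
      = p.eval y := by
  choose r hr hre using exists_polynomial_rchoose
  set L : ℝ[X] := ∑ k ∈ Finset.range (n + 1),
    r k * (r (n - k)).comp (C (n : ℝ) - X) * C (p.eval (k : ℝ)) with hL
  have hLe (x : ℝ) : L.eval x = ∑ k ∈ Finset.range (n + 1),
      rchoose x k * rchoose ((n : ℝ) - x) (n - k) * p.eval (k : ℝ) := by
    simp [hL, eval_finsetSum, hre]
  have hLd : L.natDegree ≤ n := by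
    refine natDegree_sum_le_of_forall_le _ _ fun k hk => ?_
    have hk' : k ≤ n := Nat.lt_succ_iff.mp (Finset.mem_range.mp hk)
    have h1 : (C (n : ℝ) - X : ℝ[X]).natDegree ≤ 1 :=
      (natDegree_sub_le _ _).trans (by simp)
    have h2 : ((r (n - k)).comp (C (n : ℝ) - X)).natDegree ≤ n - k :=
      natDegree_comp_le.trans ((Nat.mul_le_mul (hr _) h1).trans (by simp))
    refine (natDegree_mul_C_le _ _).trans (natDegree_mul_le.trans ?_)
    have := hr k
    omega
  have hlt {f : ℝ[X]} (hf : f.natDegree ≤ n) :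
      f.degree < ((Finset.range (n + 1)).card : ℕ) := by
    rw [Finset.card_range]
    exact (degree_le_of_natDegree_le hf).trans_lt (by exact_mod_cast n.lt_succ_self)
  have hLp : L = p := by
    refine eq_of_degrees_lt_of_eval_index_eq (v := fun i : ℕ => (i : ℝ)) (Finset.range (n + 1))
      (Nat.cast_injective.injOn) (hlt hLd) (hlt hp) fun i hi => ?_
    have hin : i ≤ n := Nat.lt_succ_iff.mp (Finset.mem_range.mp hi)
    rw [hLe, Finset.sum_eq_single_of_mem i hi, ← Nat.cast_sub hin, rchoose_natCast_self,
      rchoose_natCast_self, one_mul, one_mul]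
    intro k hk hki
    rcases hki.lt_or_gt with h | h
    · rw [← Nat.cast_sub hin, rchoose_natCast_of_lt (i := n - i) (by omega), mul_zero, zero_mul]
    · rw [rchoose_natCast_of_lt h, zero_mul, zero_mul]
  rw [← hLe, hLp]

/-- for integer order `t = m ≥ 1`, the associated sequence of the
generalized Bernoulli polynomials reduces to `b_n(m) = s(m+n,m)/C(m+n,n)`. -/
theorem generalizedBernoulli_coeff_integer_order (m : ℕ) (hm : 1 ≤ m) (n : ℕ) :
    ∑ k ∈ Finset.range (n + 1),
        rchoose (m : ℝ) k * rchoose ((n : ℝ) - (m : ℝ)) (n - k) / (((k + n).choose n : ℕ) : ℝ) *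
          stirling1 (k + n) k
      = stirling1 (m + n) m / (((m + n).choose n : ℕ) : ℝ) := by
  obtain ⟨p, hp, hpe⟩ := exists_polynomial_stirling1_div_choose n
  rw [← hpe m, ← sum_rchoose_mul_rchoose_mul_eval n p hp m]
  refine Finset.sum_congr rfl fun k _ => ?_
  rw [hpe k]
  ring
end

section
/- Let x_1, x_2 be real numbers and x = x_1 + x_2. Then for every n ≥ 0, Σ_{k=0}^n C(n,k) B_k(x_1) B_{n−k}(x_2) = 2 Σ_{k=0}^n [(−1)^k H_{k+1}/(k+2)] · Δ^k I_n(x), where H_j = Σ_{i=1}^j 1/i is the j-th harmonic number and B_k denotes the k-th Bernoulli polynomial. -/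
open Finset MeasureTheory

namespace PowerSeries

variable {A : Type*} [CommRing A] [Algebra ℚ A]

theorem one_add_X_mul_deriv_log : (1 + X) * derivative A (log A) = 1 := by
  rw [deriv_log]
  ext n
  cases n with
  | zero => simp [add_mul]
  | succ n => simp [add_mul, coeff_succ_X_mul, coeff_one, pow_succ]

theorem log_subst_exp_sub_one [IsAddTorsionFree A] : (log A).subst (exp A - 1) = (X : A⟦X⟧) := by
  have hs : HasSubst (exp A - 1) := HasSubst.exp_sub_one
  have h := congrArg (subst (exp A - 1)) (one_add_X_mul_deriv_log (A := A))
  rw [subst_mul hs, subst_add hs, subst_X hs, ← coe_substAlgHom hs, map_one,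
    coe_substAlgHom hs, add_sub_cancel] at h
  refine derivative.ext ?_ ?_
  · rw [derivative_subst hs, map_sub, derivative_exp, derivative_one, sub_zero, derivative_X,
      mul_comm, h]
  · rw [constantCoeff_X]
    exact constantCoeff_logOf constantCoeff_exp

theorem X_dvd_exp_sub_one : (X : A⟦X⟧) ∣ exp A - 1 := by
  rw [X_dvd_iff]; simp

theorem exp_sub_one_ne_zero [Nontrivial A] : exp A - 1 ≠ 0 := by
  intro h
  simpa using congrArg (coeff 1) h

/-- Since `g` has no constant term, only the first `n + 1` terms of `f` contribute to the
`n`-th coefficient of `f(g) * h`. -/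
theorem coeff_subst_mul_of_X_dvd {R : Type*} [CommRing R] (f h : R⟦X⟧) {g : R⟦X⟧} (hg : X ∣ g)
    (n : ℕ) :
    coeff n (f.subst g * h) = ∑ k ∈ Finset.range (n + 1), coeff k f * coeff n (g ^ k * h) := by
  have hs : HasSubst g := HasSubst.of_constantCoeff_zero' (X_dvd_iff.1 hg)
  have hz : ∀ r : R⟦X⟧, coeff n (g ^ (n + 1) * r) = 0 := fun r =>
    X_pow_dvd_iff.1 (dvd_mul_of_dvd_left (pow_dvd_pow_of_dvd hg (n + 1)) r) n (Nat.lt_succ_self n)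
  rw [eq_X_pow_mul_shift_add_trunc (n + 1) f, subst_add hs, subst_mul hs, subst_pow hs,
    subst_X hs, subst_coe hs, add_mul, map_add, mul_assoc, hz, zero_add,
    ← eq_X_pow_mul_shift_add_trunc, Polynomial.aeval_eq_sum_range' (natDegree_trunc_lt f n),
    Finset.sum_mul, map_sum]
  refine Finset.sum_congr rfl fun k hk => ?_
  rw [coeff_trunc, if_pos (Finset.mem_range.1 hk), smul_mul_assoc, coeff_smul, smul_eq_mul]

end PowerSeries

open PowerSeries in
theorem coeff_log_mul_deriv_log (n : ℕ) :
    coeff n (log ℝ * derivative ℝ (log ℝ)) = (-1) ^ (n + 1) * harm n := by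
  rw [deriv_log, coeff_mul, Finset.Nat.sum_antidiagonal_eq_sum_range_succ_mk,
    Finset.sum_range_succ', harm, Finset.mul_sum]
  simp only [coeff_log, coeff_mk]
  rw [if_pos trivial, zero_mul, add_zero]
  refine Finset.sum_congr rfl fun i hi => ?_
  obtain ⟨m, rfl⟩ := Nat.exists_eq_add_of_lt (Finset.mem_range.1 hi)
  rw [if_neg (Nat.succ_ne_zero i), show i + m + 1 - (i + 1) = m by omega]
  simp only [map_div₀, map_pow, map_neg, map_one, map_natCast]
  push_cast
  ring

/-- The power series `(log (1 + X) / X) ^ 2`. -/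
noncomputable def logDivXSq : PowerSeries ℝ :=
  PowerSeries.mk fun k => 2 * ((-1) ^ k * harm (k + 1) / ((k : ℝ) + 2))

open PowerSeries in
theorem X_sq_mul_logDivXSq : X ^ 2 * logDivXSq = log ℝ ^ 2 := by
  refine derivative.ext ?_ (by simp)
  ext n
  have h : derivative ℝ (log ℝ ^ 2) = C 2 * (log ℝ * derivative ℝ (log ℝ)) := by
    rw [derivative_pow, map_ofNat]
    push_cast
    ring
  rw [h, coeff_C_mul, coeff_log_mul_deriv_log, coeff_derivative]
  cases n with
  | zero => simp [harm, coeff_X_pow_mul']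
  | succ m =>
    rw [show m + 1 + 1 = m + 2 from rfl, coeff_X_pow_mul, logDivXSq, coeff_mk]
    have : (m : ℝ) + 2 ≠ 0 := by positivity
    push_cast
    field_simp
    ring

open PowerSeries in
theorem logDivXSq_subst_exp_sub_one_mul :
    logDivXSq.subst (exp ℝ - 1) * (exp ℝ - 1) ^ 2 = X ^ 2 := by
  have hs : HasSubst (exp ℝ - 1) := HasSubst.exp_sub_one
  have h := congrArg (subst (exp ℝ - 1)) X_sq_mul_logDivXSq
  rwa [subst_mul hs, subst_pow hs, subst_pow hs, subst_X hs, log_subst_exp_sub_one,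
    mul_comm] at h

open PowerSeries in
theorem coeff_exp_sub_one_pow_mul_rescale_exp (n k : ℕ) (x : ℝ) :
    coeff n ((exp ℝ - 1) ^ k * rescale x (exp ℝ))
      = fdiff k (fun y => y ^ n) x / n.factorial := by
  rw [sub_eq_add_neg, add_pow, Finset.sum_mul, map_sum, fdiff, Finset.sum_div]
  refine Finset.sum_congr rfl fun j _ => ?_
  have h : exp ℝ ^ j * (-1) ^ (k - j) * (k.choose j : ℝ⟦X⟧) * rescale x (exp ℝ)
      = C ((k.choose j : ℝ) * (-1) ^ (k - j)) * rescale (x + j) (exp ℝ) := by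
    rw [exp_pow_eq_rescale_exp, ← exp_mul_exp_eq_exp_add]
    simp only [map_mul, map_pow, map_neg, map_one, map_natCast]
    ring
  rw [h, coeff_C_mul, coeff_rescale, coeff_exp]
  simp only [map_div₀, map_one, map_natCast]
  ring

open PowerSeries in
theorem coeff_bernoulli_generating_function_mul (x₁ x₂ : ℝ) (n : ℕ) :
    coeff n
        ((mk fun n => Polynomial.aeval x₁ ((1 / n.factorial : ℚ) • Polynomial.bernoulli n)) *
          mk fun n => Polynomial.aeval x₂ ((1 / n.factorial : ℚ) • Polynomial.bernoulli n))
      = (∑ k ∈ Finset.range (n + 1), (n.choose k : ℝ) *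
          (Polynomial.aeval x₁) (Polynomial.bernoulli k) *
          (Polynomial.aeval x₂) (Polynomial.bernoulli (n - k))) / n.factorial := by
  rw [coeff_mul, Finset.Nat.sum_antidiagonal_eq_sum_range_succ_mk, Finset.sum_div]
  refine Finset.sum_congr rfl fun k hk => ?_
  have hn : (n.factorial : ℝ) ≠ 0 := by positivity
  simp only [coeff_mk, map_smul, Rat.smul_def]
  rw [Nat.cast_choose ℝ (Finset.mem_range_succ_iff.1 hk)]
  push_cast
  field_simp

/-- second-order convolution identity for Bernoulli polynomials in terms of
harmonic numbers:
`∑_{k=0}^n C(n,k) B_k(x₁)B_{n-k}(x₂) = 2 ∑_{k=0}^n [(-1)^k H_{k+1}/(k+2)] Δ^k I_n(x)`. -/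
theorem bernoulli_convolution_harmonic (x₁ x₂ : ℝ) (x : ℝ) (hx : x₁ + x₂ = x) (n : ℕ) :
    ∑ k ∈ Finset.range (n + 1), (n.choose k : ℝ) *
        (Polynomial.aeval x₁) (Polynomial.bernoulli k) *
        (Polynomial.aeval x₂) (Polynomial.bernoulli (n - k))
      = 2 * ∑ k ∈ Finset.range (n + 1),
          (-1 : ℝ) ^ k * harm (k + 1) / ((k : ℝ) + 2) * fdiff k (fun y => y ^ n) x := by
  have hgen : (PowerSeries.mk fun n =>
        Polynomial.aeval x₁ ((1 / n.factorial : ℚ) • Polynomial.bernoulli n)) *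
      (PowerSeries.mk fun n =>
        Polynomial.aeval x₂ ((1 / n.factorial : ℚ) • Polynomial.bernoulli n))
      = logDivXSq.subst (PowerSeries.exp ℝ - 1) *
        PowerSeries.rescale x (PowerSeries.exp ℝ) := by
    refine mul_right_cancel₀
      (pow_ne_zero 2 (PowerSeries.exp_sub_one_ne_zero (A := ℝ))) ?_
    rw [mul_right_comm (logDivXSq.subst _), logDivXSq_subst_exp_sub_one_mul, ← hx,
      ← PowerSeries.exp_mul_exp_eq_exp_add, sq, mul_mul_mul_comm,
      Polynomial.bernoulli_generating_function, Polynomial.bernoulli_generating_function]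
    ring
  have h := congrArg (PowerSeries.coeff n) hgen
  rw [coeff_bernoulli_generating_function_mul,
    PowerSeries.coeff_subst_mul_of_X_dvd _ _ PowerSeries.X_dvd_exp_sub_one] at h
  rw [(div_eq_iff (Nat.cast_ne_zero.2 n.factorial_ne_zero)).1 h, Finset.sum_mul, Finset.mul_sum]
  refine Finset.sum_congr rfl fun k _ => ?_
  rw [coeff_exp_sub_one_pow_mul_rescale_exp, logDivXSq, PowerSeries.coeff_mk, mul_assoc,
    div_mul_cancel₀ _ (Nat.cast_ne_zero.2 n.factorial_ne_zero), mul_assoc]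
end
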